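/- arXiv:1609.04744 — 2 statements merged into one kernel-verified Lean document; each statement's English description precedes it below -/
import Mathlib

section
/- Suppose α : P(E) → (−∞,∞] is convex and has weakly compact sub-level sets, and define ρ(f) = sup_{ν ∈ P(E)} (∫ f dν − α(ν)) for f ∈ B(E). Then: (R1) ρ is monotone: f ≥ g pointwise implies ρ(f) ≥ ρ(g); (R2) ρ(f + c) = ρ(f) + c for all f ∈ B(E) and c ∈ ℝ; (R3) if f_n ∈ B(E) increase pointwise to f ∈ B(E), then ρ(f_n) ↑ ρ(f); (R4) if f_n ∈ C_b(E) decrease pointwise to f ∈ B(E), then ρ(f_n) ↓ ρ(f). Moreover, for every ν ∈ P(E), α(ν) = sup_{f ∈ C_b(E)} (∫ f dν − ρ(f)). -/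
open MeasureTheory ProbabilityTheory Filter Topology Set
open scoped ENNReal NNReal

noncomputable section

namespace SanovDual

attribute [local instance] Classical.propDecidable

/-- The integral of an `EReal`-valued function, with the convention `∞ - ∞ := -∞`. -/
def erealIntegral {X : Type*} [MeasurableSpace X] (μ : Measure X) (f : X → EReal) : EReal :=
  if (∫⁻ x, (if f x = ⊥ then ⊤ else ENNReal.ofReal (-(f x).toReal)) ∂μ) = ⊤ then ⊥
  else ((∫⁻ x, (if f x = ⊤ then ⊤ else ENNReal.ofReal ((f x).toReal)) ∂μ : ℝ≥0∞) : EReal)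
      - ((∫⁻ x, (if f x = ⊥ then ⊤ else ENNReal.ofReal (-(f x).toReal)) ∂μ : ℝ≥0∞) : EReal)

/-- Extension of a function on probability measures to all measures (value `∞` elsewhere). -/
def extend {E : Type*} [MeasurableSpace E] (α : ProbabilityMeasure E → EReal)
    (μ : Measure E) : EReal :=
  if h : IsProbabilityMeasure μ then α ⟨μ, h⟩ else ⊤

/-- The conditional law of the `k`-th coordinate given the first `k` coordinates (`0`-indexed:
given coordinates `0, …, k-1`), under a probability measure on `Fin n → E`. -/
def condLaw {E : Type*} [MeasurableSpace E] [TopologicalSpace E] [PolishSpace E] [BorelSpace E]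
    [Nonempty E] (n : ℕ) (ν : ProbabilityMeasure (Fin n → E)) (k : Fin n) :
    Kernel (Fin (k : ℕ) → E) E :=
  Measure.condKernel ((ν : Measure (Fin n → E)).map
      (fun x => ((fun i : Fin (k : ℕ) => x (Fin.castLE k.isLt.le i)), x k)))

/-- The functional `α_n` on `P(E^n)` built from `α` by summing `α` applied to the successive
conditional laws in the disintegration. -/
def alphan {E : Type*} [MeasurableSpace E] [TopologicalSpace E] [PolishSpace E] [BorelSpace E]
    [Nonempty E] (α : ProbabilityMeasure E → EReal) (n : ℕ)
    (ν : ProbabilityMeasure (Fin n → E)) : EReal :=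
  ∑ k : Fin n, erealIntegral (ν : Measure (Fin n → E))
    (fun x => extend α (condLaw n ν k (fun i => x (Fin.castLE k.isLt.le i))))

/-- The convex conjugate `ρ_n` of `α_n`, acting on (extended-real-valued) functions on `E^n`. -/
def rhon {E : Type*} [MeasurableSpace E] [TopologicalSpace E] [PolishSpace E] [BorelSpace E]
    [Nonempty E] (α : ProbabilityMeasure E → EReal) (n : ℕ) (f : (Fin n → E) → EReal) : EReal :=
  ⨆ ν : ProbabilityMeasure (Fin n → E), erealIntegral (ν : Measure (Fin n → E)) f - alphan α n ν

/-- `ρ = ρ₁` on bounded (real-valued) functions. -/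
def rho {E : Type*} [MeasurableSpace E] (α : ProbabilityMeasure E → EReal) (f : E → ℝ) : EReal :=
  ⨆ ν : ProbabilityMeasure E, ((∫ x, f x ∂(ν : Measure E) : ℝ) : EReal) - α ν

/-- `ρ` on extended-real-valued functions, with the convention `∞ - ∞ := -∞` for integrals. -/
def rhoE {E : Type*} [MeasurableSpace E] (α : ProbabilityMeasure E → EReal) (f : E → EReal) :
    EReal :=
  ⨆ ν : ProbabilityMeasure E, erealIntegral (ν : Measure E) f - α ν

/-- `ρ` on `[0,∞]`-valued functions. -/
def rhoNN {E : Type*} [MeasurableSpace E] (α : ProbabilityMeasure E → EReal) (g : E → ℝ≥0∞) :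
    EReal :=
  ⨆ ν : ProbabilityMeasure E, ((∫⁻ x, g x ∂(ν : Measure E) : ℝ≥0∞) : EReal) - α ν

/-- The empirical measure `L_n(x) = n⁻¹ ∑ δ_{x_i}` as a measure. -/
def empMeasure {E : Type*} [MeasurableSpace E] (n : ℕ) (x : Fin n → E) : Measure E :=
  (n : ℝ≥0∞)⁻¹ • ∑ i : Fin n, Measure.dirac (x i)

/-- The empirical measure `L_n(x)` as a probability measure (junk value for `n = 0`). -/
def empirical {E : Type*} [MeasurableSpace E] [Nonempty E] (n : ℕ) (x : Fin n → E) :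
    ProbabilityMeasure E :=
  if h : IsProbabilityMeasure (empMeasure n x) then ⟨empMeasure n x, h⟩
  else ⟨Measure.dirac (Classical.arbitrary E), inferInstance⟩

/-- `P_ψ(E)`, the probability measures integrating `ψ`. -/
def Pw (E : Type*) [MeasurableSpace E] (ψ : E → ℝ) : Type _ :=
  {ν : ProbabilityMeasure E // ∫⁻ x, ENNReal.ofReal (ψ x) ∂(ν : Measure E) ≠ ⊤}

/-- The underlying probability measure of an element of `P_ψ(E)`. -/
def Pw.toProb {E : Type*} [MeasurableSpace E] {ψ : E → ℝ} (ν : Pw E ψ) :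
    ProbabilityMeasure E :=
  Subtype.val ν

/-- The `ψ`-weak topology on `P_ψ(E)`: the topology generated by the maps `ν ↦ ∫ f dν` over
continuous `f : E → ℝ` with `|f| ≤ 1 + ψ`. -/
instance {E : Type*} [MeasurableSpace E] [TopologicalSpace E] (ψ : E → ℝ) :
    TopologicalSpace (Pw E ψ) :=
  ⨅ (f : E → ℝ) (_ : Continuous f) (_ : ∀ x, |f x| ≤ 1 + ψ x),
    TopologicalSpace.induced (fun ν : Pw E ψ => ∫ x, f x ∂(ν.toProb : Measure E)) inferInstance

/-- Lift a function on `P_ψ(E)` to one on `P(E)` (junk value `⊤` off `P_ψ(E)`). -/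
def liftPw {E : Type*} [MeasurableSpace E] (ψ : E → ℝ) (F : Pw E ψ → EReal)
    (ν : ProbabilityMeasure E) : EReal :=
  if h : ∫⁻ x, ENNReal.ofReal (ψ x) ∂(ν : Measure E) ≠ ⊤ then F ⟨ν, h⟩ else ⊤

/-- The canonical map `EReal → ℝ≥0∞`. -/
def erealToENNReal (x : EReal) : ℝ≥0∞ :=
  if x = ⊤ then ⊤ else ENNReal.ofReal x.toReal

instance {E : Type*} [MeasurableSpace E] : MeasurableSpace (ProbabilityMeasure E) :=
  Subtype.instMeasurableSpace

theorem lowerSemicontinuous_of_isCompact_sublevel {X : Type*} [TopologicalSpace X] [T2Space X]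
    {α : X → EReal} (hbot : ∀ x, α x ≠ ⊥)
    (hcompact : ∀ c : ℝ, IsCompact {x | α x ≤ (c : EReal)}) : LowerSemicontinuous α := by
  refine lowerSemicontinuous_iff_isClosed_preimage.2 fun y ↦ ?_
  induction y with
  | bot =>
    convert isClosed_empty
    ext x
    simpa using hbot x
  | coe c => exact (hcompact c).isClosed
  | top =>
    convert isClosed_univ
    ext x
    simp

theorem exists_real_lower_bound {X : Type*} [TopologicalSpace X] [T2Space X]
    {α : X → EReal} (hbot : ∀ x, α x ≠ ⊥)
    (hcompact : ∀ c : ℝ, IsCompact {x | α x ≤ (c : EReal)}) : ∃ m : ℝ, ∀ x, (m : EReal) ≤ α x := by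
  by_contra! h
  obtain ⟨x, hx⟩ := IsCompact.nonempty_iInter_of_sequence_nonempty_isCompact_isClosed
    (fun n : ℕ ↦ {x | α x ≤ ((-n : ℝ) : EReal)})
    (fun n x hx ↦ le_trans hx (EReal.coe_le_coe_iff.2 (by push_cast; linarith)))
    (fun n ↦ (h (-n)).imp fun x hx ↦ hx.le) (hcompact _) (fun n ↦ (hcompact _).isClosed)
  refine hbot x ((EReal.eq_bot_iff_forall_lt _).2 fun y ↦ ?_)
  obtain ⟨n, hn⟩ := exists_nat_gt (-y)
  exact (Set.mem_iInter.1 hx n).trans_lt (EReal.coe_lt_coe_iff.2 (by linarith))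

theorem integrable_of_bounded {E : Type*} [MeasurableSpace E] (μ : ProbabilityMeasure E)
    {f : E → ℝ} (hf : Measurable f) (hb : ∃ C : ℝ, ∀ x, |f x| ≤ C) :
    Integrable f (μ : Measure E) := by
  obtain ⟨C, hC⟩ := hb
  exact Integrable.of_bound hf.aestronglyMeasurable C (ae_of_all _ hC)

theorem rho_mono {E : Type*} [MeasurableSpace E] (α : ProbabilityMeasure E → EReal) {f g : E → ℝ}
    (hf : Measurable f) (hfb : ∃ C : ℝ, ∀ x, |f x| ≤ C)
    (hg : Measurable g) (hgb : ∃ C : ℝ, ∀ x, |g x| ≤ C) (h : ∀ x, g x ≤ f x) :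
    rho α g ≤ rho α f :=
  iSup_mono fun μ ↦ EReal.sub_le_sub (EReal.coe_le_coe_iff.2
    (integral_mono (integrable_of_bounded μ hg hgb) (integrable_of_bounded μ hf hfb) h)) le_rfl

theorem rho_add_const_le {E : Type*} [MeasurableSpace E] (α : ProbabilityMeasure E → EReal)
    {f : E → ℝ} (hf : Measurable f) (hfb : ∃ C : ℝ, ∀ x, |f x| ≤ C) (c : ℝ) :
    rho α (fun x ↦ f x + c) ≤ rho α f + c := by
  refine iSup_le fun μ ↦ ?_
  have h : ∫ x, (f x + c) ∂(μ : Measure E) = ∫ x, f x ∂(μ : Measure E) + c := by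
    rw [integral_add (integrable_of_bounded μ hf hfb) (integrable_const c)]
    simp
  rw [h, EReal.coe_add, sub_eq_add_neg, add_right_comm, ← sub_eq_add_neg]
  exact add_le_add_left
    (le_iSup (fun ν : ProbabilityMeasure E ↦ ((∫ x, f x ∂(ν : Measure E) : ℝ) : EReal) - α ν) μ) _

theorem bounded_add_const {X : Type*} {f : X → ℝ} (hb : ∃ C : ℝ, ∀ x, |f x| ≤ C) (c : ℝ) :
    ∃ C : ℝ, ∀ x, |f x + c| ≤ C := by
  obtain ⟨C, hC⟩ := hb
  exact ⟨C + |c|, fun x ↦ (abs_add_le _ _).trans (by linarith [hC x])⟩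

theorem rho_add_const {E : Type*} [MeasurableSpace E] (α : ProbabilityMeasure E → EReal)
    {f : E → ℝ} (hf : Measurable f) (hfb : ∃ C : ℝ, ∀ x, |f x| ≤ C) (c : ℝ) :
    rho α (fun x ↦ f x + c) = rho α f + c := by
  refine le_antisymm (rho_add_const_le α hf hfb c) ?_
  have h := rho_add_const_le α (hf.add_const c) (bounded_add_const hfb c) (-c)
  simp only [add_neg_cancel_right] at h
  calc rho α f + c ≤ rho α (fun x ↦ f x + c) + ((-c : ℝ) : EReal) + c := add_le_add_left h _
    _ = rho α (fun x ↦ f x + c) := by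
      rw [add_assoc, ← EReal.coe_add, neg_add_cancel, EReal.coe_zero, add_zero]

theorem tendsto_integral_of_bounded {E : Type*} [MeasurableSpace E] (μ : ProbabilityMeasure E)
    {fs : ℕ → E → ℝ} {f : E → ℝ} (hfs : ∀ m, Measurable (fs m)) {C : ℝ}
    (hC : ∀ m x, |fs m x| ≤ C) (hlim : ∀ x, Tendsto (fun m ↦ fs m x) atTop (𝓝 (f x))) :
    Tendsto (fun m ↦ ∫ x, fs m x ∂(μ : Measure E)) atTop (𝓝 (∫ x, f x ∂(μ : Measure E))) :=
  tendsto_integral_of_dominated_convergence (fun _ ↦ C)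
    (fun m ↦ (hfs m).aestronglyMeasurable) (integrable_const C)
    (fun m ↦ ae_of_all _ (hC m)) (ae_of_all _ hlim)

theorem tendsto_rho_of_monotone {E : Type*} [MeasurableSpace E] (α : ProbabilityMeasure E → EReal)
    (hbot : ∀ ν, α ν ≠ ⊥) {fs : ℕ → E → ℝ} {f : E → ℝ} (hfs : ∀ m, Measurable (fs m))
    (hfsb : ∀ m, ∃ C : ℝ, ∀ x, |fs m x| ≤ C) (hf : Measurable f) (hfb : ∃ C : ℝ, ∀ x, |f x| ≤ C)
    (hmono : ∀ x, Monotone fun m ↦ fs m x)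
    (hlim : ∀ x, Tendsto (fun m ↦ fs m x) atTop (𝓝 (f x))) :
    Tendsto (fun m ↦ rho α (fs m)) atTop (𝓝 (rho α f)) := by
  have hle : ∀ m x, fs m x ≤ f x := fun m x ↦ (hmono x).ge_of_tendsto (hlim x) m
  have hsup : rho α f = ⨆ m, rho α (fs m) := by
    refine le_antisymm (iSup_le fun μ ↦ ?_)
      (iSup_le fun m ↦ rho_mono α hf hfb (hfs m) (hfsb m) (hle m))
    obtain ⟨C, hC⟩ := hfb
    obtain ⟨D, hD⟩ := hfsb 0
    have hCD : ∀ m x, |fs m x| ≤ max C D := fun m x ↦ abs_le.2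
      ⟨(neg_le_neg (le_max_right C D)).trans ((abs_le.1 (hD x)).1.trans (hmono x (Nat.zero_le m))),
        (hle m x).trans ((abs_le.1 (hC x)).2.trans (le_max_left C D))⟩
    by_cases hμ : α μ = ⊤
    · simp [hμ]
    have ht := (continuous_coe_real_ereal.tendsto _).comp
      (tendsto_integral_of_bounded μ hfs hCD hlim)
    refine EReal.sub_le_of_le_add (le_of_tendsto ht (Eventually.of_forall fun m ↦ ?_))
    refine (EReal.sub_le_iff_le_add (.inl (hbot μ)) (.inl hμ)).1
      ((le_iSup (fun ν : ProbabilityMeasure E ↦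
        ((∫ x, fs m x ∂(ν : Measure E) : ℝ) : EReal) - α ν) μ).trans
        (le_iSup (fun m ↦ rho α (fs m)) m))
  rw [hsup]
  exact tendsto_atTop_iSup fun m n hmn ↦
    rho_mono α (hfs n) (hfsb n) (hfs m) (hfsb m) fun x ↦ hmono x hmn

theorem isClosed_setOf_le_integral_sub {E : Type*} [MeasurableSpace E] [TopologicalSpace E]
    [OpensMeasurableSpace E] {α : ProbabilityMeasure E → EReal} (hα : LowerSemicontinuous α)
    {f : E → ℝ} (hf : Continuous f) (hfb : ∃ C : ℝ, ∀ x, |f x| ≤ C) (r : ℝ) :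
    IsClosed {μ : ProbabilityMeasure E |
      α μ ≤ ((∫ x, f x ∂(μ : Measure E) - r : ℝ) : EReal)} := by
  obtain ⟨C, hC⟩ := hfb
  have hcont : Continuous fun μ : ProbabilityMeasure E ↦ ∫ x, f x ∂(μ : Measure E) :=
    ProbabilityMeasure.continuous_integral_boundedContinuousFunction
      (BoundedContinuousFunction.ofNormedAddCommGroup f hf C hC)
  exact hα.isClosed_epigraph.preimage
    (continuous_id.prodMk (continuous_coe_real_ereal.comp (hcont.sub continuous_const)))

theorem tendsto_rho_of_antitone {E : Type*} [MeasurableSpace E] [TopologicalSpace E]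
    [OpensMeasurableSpace E] [T2Space (ProbabilityMeasure E)]
    {α : ProbabilityMeasure E → EReal} (hbot : ∀ ν, α ν ≠ ⊥)
    (hcompact : ∀ c : ℝ, IsCompact {ν : ProbabilityMeasure E | α ν ≤ (c : EReal)})
    {fs : ℕ → E → ℝ} {f : E → ℝ} (hfs : ∀ m, Continuous (fs m))
    (hfsb : ∀ m, ∃ C : ℝ, ∀ x, |fs m x| ≤ C) (hf : Measurable f) (hfb : ∃ C : ℝ, ∀ x, |f x| ≤ C)
    (hanti : ∀ x, Antitone fun m ↦ fs m x)
    (hlim : ∀ x, Tendsto (fun m ↦ fs m x) atTop (𝓝 (f x))) :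
    Tendsto (fun m ↦ rho α (fs m)) atTop (𝓝 (rho α f)) := by
  have hle : ∀ m x, f x ≤ fs m x := fun m x ↦ (hanti x).le_of_tendsto (hlim x) m
  have hlsc := lowerSemicontinuous_of_isCompact_sublevel hbot hcompact
  have hinf : rho α f = ⨅ m, rho α (fs m) := by
    refine le_antisymm
      (le_iInf fun m ↦ rho_mono α (hfs m).measurable (hfsb m) hf hfb (hle m))
      (EReal.ge_of_forall_gt_iff_ge.1 fun r hr ↦ ?_)
    obtain ⟨C, hC⟩ := hfb
    obtain ⟨D, hD⟩ := hfsb 0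
    have hCD : ∀ m x, |fs m x| ≤ max C D := fun m x ↦ abs_le.2
      ⟨(neg_le_neg (le_max_left C D)).trans ((abs_le.1 (hC x)).1.trans (hle m x)),
        (hanti x (Nat.zero_le m)).trans ((abs_le.1 (hD x)).2.trans (le_max_right C D))⟩
    have hint : ∀ m (μ : ProbabilityMeasure E), Integrable (fs m) (μ : Measure E) :=
      fun m μ ↦ integrable_of_bounded μ (hfs m).measurable (hfsb m)
    have hclosed := fun m ↦ isClosed_setOf_le_integral_sub hlsc (hfs m) (hfsb m) r
    obtain ⟨μ, hμ⟩ := IsCompact.nonempty_iInter_of_sequence_nonempty_isCompact_isClosed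
      (fun m ↦ {μ : ProbabilityMeasure E |
        α μ ≤ ((∫ x, fs m x ∂(μ : Measure E) - r : ℝ) : EReal)})
      (fun m μ hμ ↦ le_trans hμ (EReal.coe_le_coe_iff.2 (sub_le_sub_right
        (integral_mono (hint _ _) (hint _ _) fun x ↦ hanti x m.le_succ) r)))
      (fun m ↦ by
        obtain ⟨μ, hμ⟩ := lt_iSup_iff.1 (hr.trans_le (iInf_le _ m))
        refine ⟨μ, ?_⟩
        have h := EReal.add_lt_of_lt_sub hμ
        rw [Set.mem_ofPred_eq, EReal.coe_sub]
        exact (EReal.le_sub_iff_add_le (.inl (EReal.coe_ne_bot r)) (.inl (EReal.coe_ne_top r))).2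
          (by rw [add_comm]; exact h.le))
      ((hcompact (D - r)).of_isClosed_subset (hclosed 0) fun μ hμ ↦
        le_trans hμ (EReal.coe_le_coe_iff.2 (sub_le_sub_right
          ((integral_mono (hint _ _) (integrable_const D) fun x ↦ (abs_le.1 (hD x)).2).trans_eq
            (by simp)) r)))
      hclosed
    have ht := (continuous_coe_real_ereal.tendsto _).comp
      ((tendsto_integral_of_bounded μ (fun m ↦ (hfs m).measurable) hCD hlim).sub_const r)
    have hle' : α μ ≤ ((∫ x, f x ∂(μ : Measure E) - r : ℝ) : EReal) :=
      ge_of_tendsto ht (Eventually.of_forall fun m ↦ Set.mem_iInter.1 hμ m)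
    refine le_trans ?_ (le_iSup (fun ν : ProbabilityMeasure E ↦
        ((∫ x, f x ∂(ν : Measure E) : ℝ) : EReal) - α ν) μ)
    refine le_trans (le_of_eq ?_) (EReal.sub_le_sub le_rfl hle')
    rw [← EReal.coe_sub, sub_sub_cancel]
  rw [hinf]
  exact tendsto_atTop_iInf fun m n hmn ↦
    rho_mono α (hfs m).measurable (hfsb m) (hfs n).measurable (hfsb n) fun x ↦ hanti x hmn

theorem rho_le_coe {E : Type*} [MeasurableSpace E] {α : ProbabilityMeasure E → EReal}
    (hbot : ∀ ν, α ν ≠ ⊥) {f : E → ℝ} {K : ℝ}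
    (h : ∀ (μ : ProbabilityMeasure E) (r : ℝ), α μ ≤ r → ∫ x, f x ∂(μ : Measure E) - r ≤ K) :
    rho α f ≤ K := by
  refine iSup_le fun μ ↦ ?_
  by_cases hμ : α μ = ⊤
  · simp [hμ]
  · rw [← EReal.coe_toReal hμ (hbot μ), ← EReal.coe_sub]
    exact EReal.coe_le_coe_iff.2 (h μ _ (EReal.le_coe_toReal hμ))

theorem exists_integral_eq_of_continuous {E : Type*} [MeasurableSpace E] [TopologicalSpace E]
    [OpensMeasurableSpace E]
    (φ : (BoundedContinuousFunction E ℝ → ℝ) →L[ℝ] ℝ) :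
    ∃ g : BoundedContinuousFunction E ℝ, ∀ μ : ProbabilityMeasure E,
      φ (fun f ↦ ∫ x, f x ∂(μ : Measure E)) = ∫ x, g x ∂(μ : Measure E) := by
  have hspan : (φ : (BoundedContinuousFunction E ℝ → ℝ) →ₗ[ℝ] ℝ) ∈ Submodule.span ℝ
      (Set.range fun i : BoundedContinuousFunction E ℝ ↦
        (LinearMap.proj i : (BoundedContinuousFunction E ℝ → ℝ) →ₗ[ℝ] ℝ)) :=
    (LinearMap.mem_span_iff_continuous _).2 φ.continuous
  suffices h : ∀ ψ : (BoundedContinuousFunction E ℝ → ℝ) →ₗ[ℝ] ℝ, ψ ∈ Submodule.span ℝ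
      (Set.range fun i : BoundedContinuousFunction E ℝ ↦
        (LinearMap.proj i : (BoundedContinuousFunction E ℝ → ℝ) →ₗ[ℝ] ℝ)) →
      ∃ g : BoundedContinuousFunction E ℝ, ∀ μ : ProbabilityMeasure E,
        ψ (fun f ↦ ∫ x, f x ∂(μ : Measure E)) = ∫ x, g x ∂(μ : Measure E) from h _ hspan
  intro ψ hψ
  induction hψ using Submodule.span_induction with
  | mem ψ h =>
    obtain ⟨g, rfl⟩ := h
    exact ⟨g, fun μ ↦ rfl⟩
  | zero => exact ⟨0, fun μ ↦ by simp⟩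
  | add ψ₁ ψ₂ _ _ h₁ h₂ =>
    obtain ⟨g₁, h₁⟩ := h₁
    obtain ⟨g₂, h₂⟩ := h₂
    refine ⟨g₁ + g₂, fun μ ↦ ?_⟩
    rw [LinearMap.add_apply, h₁, h₂, ← integral_add (g₁.integrable _) (g₂.integrable _)]
    rfl
  | smul a ψ _ h =>
    obtain ⟨g, h⟩ := h
    refine ⟨a • g, fun μ ↦ ?_⟩
    rw [LinearMap.smul_apply, h, smul_eq_mul, ← integral_const_mul]
    rfl

/-- The epigraph of `α`, with each measure replaced by its integrals against bounded continuous
functions. -/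
def integralEpigraph {E : Type*} [MeasurableSpace E] [TopologicalSpace E]
    (α : ProbabilityMeasure E → EReal) : Set ((BoundedContinuousFunction E ℝ → ℝ) × ℝ) :=
  (fun p : ProbabilityMeasure E × ℝ ↦ ((fun f ↦ ∫ x, f x ∂(p.1 : Measure E)), p.2)) ''
    {p | α p.1 ≤ (p.2 : EReal)}

theorem isClosed_integralEpigraph {E : Type*} [MeasurableSpace E] [TopologicalSpace E]
    [OpensMeasurableSpace E] [T2Space (ProbabilityMeasure E)]
    {α : ProbabilityMeasure E → EReal} (hbot : ∀ ν, α ν ≠ ⊥)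
    (hcompact : ∀ c : ℝ, IsCompact {ν : ProbabilityMeasure E | α ν ≤ (c : EReal)}) :
    IsClosed (integralEpigraph α) := by
  obtain ⟨m, hm⟩ := exists_real_lower_bound hbot hcompact
  have hclosed : IsClosed {p : ProbabilityMeasure E × ℝ | α p.1 ≤ (p.2 : EReal)} :=
    (lowerSemicontinuous_of_isCompact_sublevel hbot hcompact).isClosed_epigraph.preimage
      (continuous_fst.prodMk (continuous_coe_real_ereal.comp continuous_snd))
  set Φ : ProbabilityMeasure E × ℝ → (BoundedContinuousFunction E ℝ → ℝ) × ℝ :=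
    fun p ↦ ((fun f ↦ ∫ x, f x ∂(p.1 : Measure E)), p.2) with hΦ
  have hcont : Continuous Φ := (continuous_pi fun f ↦
    (ProbabilityMeasure.continuous_integral_boundedContinuousFunction f).comp
      continuous_fst).prodMk continuous_snd
  refine isClosed_of_closure_subset fun q hq ↦ ?_
  have hK : IsCompact ({p : ProbabilityMeasure E × ℝ | α p.1 ≤ (p.2 : EReal)} ∩
      {p | p.2 ≤ q.2 + 1}) := by
    refine ((hcompact (q.2 + 1)).prod (isCompact_Icc (a := m) (b := q.2 + 1))).of_isClosed_subset
      (hclosed.inter (isClosed_le continuous_snd continuous_const)) ?_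
    rintro p ⟨hp, hp'⟩
    exact ⟨le_trans hp (EReal.coe_le_coe_iff.2 hp'),
      EReal.coe_le_coe_iff.1 ((hm p.1).trans hp), hp'⟩
  have hsub : Φ '' ({p | α p.1 ≤ (p.2 : EReal)} ∩ {p | p.2 ≤ q.2 + 1}) ⊆ integralEpigraph α :=
    Set.image_mono Set.inter_subset_left
  refine hsub ((hK.image hcont).isClosed.closure_subset (mem_closure_iff.2 fun U hU hqU ↦ ?_))
  obtain ⟨y, ⟨hyU, hy⟩, p, hp, rfl⟩ := mem_closure_iff.1 hq (U ∩ {y | y.2 < q.2 + 1})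
    (hU.inter (isOpen_lt continuous_snd continuous_const)) ⟨hqU, lt_add_one q.2⟩
  exact ⟨Φ p, hyU, p, ⟨hp, show p.2 ≤ q.2 + 1 from le_of_lt hy⟩, rfl⟩

theorem convex_integralEpigraph {E : Type*} [MeasurableSpace E] [TopologicalSpace E]
    [OpensMeasurableSpace E] {α : ProbabilityMeasure E → EReal}
    (hconvex : ∀ (μ₁ μ₂ : ProbabilityMeasure E) (t : ℝ≥0), t ≤ 1 →
      extend α ((t : ℝ≥0∞) • (μ₁ : Measure E) + ((1 - t : ℝ≥0) : ℝ≥0∞) • (μ₂ : Measure E))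
        ≤ ((t : ℝ) : EReal) * α μ₁ + (((1 - t : ℝ≥0) : ℝ) : EReal) * α μ₂) :
    Convex ℝ (integralEpigraph α) := by
  rintro _ ⟨⟨μ₁, r₁⟩, h₁, rfl⟩ _ ⟨⟨μ₂, r₂⟩, h₂, rfl⟩ a b ha hb hab
  lift a to ℝ≥0 using ha
  lift b to ℝ≥0 using hb
  have hab' : a + b = 1 := by exact_mod_cast hab
  have hb' : 1 - a = b := by rw [← hab', add_tsub_cancel_left]
  have hconv := hconvex μ₁ μ₂ a (hab' ▸ le_self_add)
  rw [hb'] at hconv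
  have hprob : IsProbabilityMeasure
      ((a : ℝ≥0∞) • (μ₁ : Measure E) + (b : ℝ≥0∞) • (μ₂ : Measure E)) :=
    ⟨by simpa using mod_cast hab'⟩
  rw [extend, dif_pos hprob] at hconv
  refine ⟨(⟨_, hprob⟩, a * r₁ + b * r₂), ?_, ?_⟩
  · refine hconv.trans ?_
    rw [EReal.coe_add, EReal.coe_mul, EReal.coe_mul]
    exact add_le_add
      (mul_le_mul_of_nonneg_left h₁ (EReal.coe_nonneg.2 a.2))
      (mul_le_mul_of_nonneg_left h₂ (EReal.coe_nonneg.2 b.2))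
  · refine Prod.ext (funext fun f ↦ ?_) rfl
    change ∫ x, f x ∂((a : ℝ≥0∞) • (μ₁ : Measure E) + (b : ℝ≥0∞) • (μ₂ : Measure E)) =
      (a : ℝ) * ∫ x, f x ∂(μ₁ : Measure E) + (b : ℝ) * ∫ x, f x ∂(μ₂ : Measure E)
    rw [integral_add_measure ((f.integrable _).smul_measure ENNReal.coe_ne_top)
      ((f.integrable _).smul_measure ENNReal.coe_ne_top), integral_smul_measure,
      integral_smul_measure]
    simp

theorem exists_separating_functional {E : Type*} [MeasurableSpace E] [TopologicalSpace E]
    [HasOuterApproxClosed E] [BorelSpace E]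
    {α : ProbabilityMeasure E → EReal}
    (hproper : ∃ ν, α ν ≠ ⊤) (hbot : ∀ ν, α ν ≠ ⊥)
    (hconvex : ∀ (μ₁ μ₂ : ProbabilityMeasure E) (t : ℝ≥0), t ≤ 1 →
      extend α ((t : ℝ≥0∞) • (μ₁ : Measure E) + ((1 - t : ℝ≥0) : ℝ≥0∞) • (μ₂ : Measure E))
        ≤ ((t : ℝ) : EReal) * α μ₁ + (((1 - t : ℝ≥0) : ℝ) : EReal) * α μ₂)
    (hcompact : ∀ c : ℝ, IsCompact {ν : ProbabilityMeasure E | α ν ≤ (c : EReal)})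
    {ν : ProbabilityMeasure E} {c : ℝ} (hc : (c : EReal) < α ν) :
    ∃ (g : BoundedContinuousFunction E ℝ) (l u : ℝ), 0 ≤ l ∧
      ∫ x, g x ∂(ν : Measure E) + l * c < u ∧
      ∀ (μ : ProbabilityMeasure E) (r : ℝ), α μ ≤ r → u < ∫ x, g x ∂(μ : Measure E) + l * r := by
  have hnot : ((fun f : BoundedContinuousFunction E ℝ ↦ ∫ x, f x ∂(ν : Measure E)), c) ∉
      integralEpigraph α := by
    rintro ⟨⟨μ, r⟩, hμ, h⟩
    obtain rfl : r = c := congrArg Prod.snd h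
    have hμν : (μ : Measure E) = ν :=
      ext_of_forall_integral_eq_of_IsFiniteMeasure fun f ↦ congrFun (congrArg Prod.fst h) f
    obtain rfl : μ = ν := Subtype.ext hμν
    exact hc.not_ge hμ
  obtain ⟨ψ, u, hψν, hψ⟩ := geometric_hahn_banach_point_closed (convex_integralEpigraph hconvex)
    (isClosed_integralEpigraph hbot hcompact) hnot
  obtain ⟨g, hg⟩ := exists_integral_eq_of_continuous (ψ.comp (ContinuousLinearMap.inl ℝ _ ℝ))
  have hsplit : ∀ (μ : ProbabilityMeasure E) (r : ℝ),
      ψ ((fun f ↦ ∫ x, f x ∂(μ : Measure E)), r) =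
        ∫ x, g x ∂(μ : Measure E) + ψ (0, 1) * r := by
    intro μ r
    rw [← hg μ, mul_comm, ← smul_eq_mul, ← map_smul, ContinuousLinearMap.comp_apply, ← map_add]
    simp
  have hsep : ∀ (μ : ProbabilityMeasure E) (r : ℝ), α μ ≤ r →
      u < ∫ x, g x ∂(μ : Measure E) + ψ (0, 1) * r := fun μ r h ↦
    hsplit μ r ▸ hψ _ ⟨(μ, r), h, rfl⟩
  refine ⟨g, ψ (0, 1), u, ?_, hsplit ν c ▸ hψν, hsep⟩
  by_contra! hneg
  obtain ⟨μ, hμ⟩ := hproper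
  set s := (u - ∫ x, g x ∂(μ : Measure E)) / ψ (0, 1)
  have h := hsep μ (max (α μ).toReal s) ((EReal.le_coe_toReal hμ).trans
    (EReal.coe_le_coe_iff.2 (le_max_left _ _)))
  have h' : ψ (0, 1) * max (α μ).toReal s ≤ ψ (0, 1) * s :=
    mul_le_mul_of_nonpos_left (le_max_right _ _) hneg.le
  rw [mul_div_cancel₀ _ hneg.ne] at h'
  linarith

theorem exists_coe_le_integral_sub_rho {E : Type*} [MeasurableSpace E] [TopologicalSpace E]
    [HasOuterApproxClosed E] [BorelSpace E]
    {α : ProbabilityMeasure E → EReal}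
    (hproper : ∃ ν, α ν ≠ ⊤) (hbot : ∀ ν, α ν ≠ ⊥)
    (hconvex : ∀ (μ₁ μ₂ : ProbabilityMeasure E) (t : ℝ≥0), t ≤ 1 →
      extend α ((t : ℝ≥0∞) • (μ₁ : Measure E) + ((1 - t : ℝ≥0) : ℝ≥0∞) • (μ₂ : Measure E))
        ≤ ((t : ℝ) : EReal) * α μ₁ + (((1 - t : ℝ≥0) : ℝ) : EReal) * α μ₂)
    (hcompact : ∀ c : ℝ, IsCompact {ν : ProbabilityMeasure E | α ν ≤ (c : EReal)})
    {ν : ProbabilityMeasure E} {c : ℝ} (hc : (c : EReal) < α ν) :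
    ∃ f : BoundedContinuousFunction E ℝ,
      (c : EReal) ≤ ((∫ x, f x ∂(ν : Measure E) : ℝ) : EReal) - rho α f := by
  obtain ⟨m, hm⟩ := exists_real_lower_bound hbot hcompact
  obtain ⟨g, l, u, hl, hν, hsep⟩ :=
    exists_separating_functional hproper hbot hconvex hcompact hc
  have hscale : ∀ (a : ℝ) (μ : ProbabilityMeasure E),
      ∫ x, (a • g) x ∂(μ : Measure E) = a * ∫ x, g x ∂(μ : Measure E) := fun a μ ↦ by
    rw [← integral_const_mul]
    rfl
  suffices h : ∃ a K : ℝ, c ≤ a * ∫ x, g x ∂(ν : Measure E) - K ∧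
      ∀ (μ : ProbabilityMeasure E) (r : ℝ), α μ ≤ r →
        a * ∫ x, g x ∂(μ : Measure E) - r ≤ K by
    obtain ⟨a, K, hcK, hK⟩ := h
    refine ⟨a • g, le_trans (EReal.coe_le_coe_iff.2 hcK) ?_⟩
    rw [hscale, EReal.coe_sub]
    exact EReal.sub_le_sub le_rfl (rho_le_coe hbot fun μ r hr ↦ (hscale a μ).symm ▸ hK μ r hr)
  rcases hl.eq_or_lt with rfl | hl
  · simp only [zero_mul, add_zero] at hν hsep
    obtain ⟨n, hn⟩ := exists_nat_gt ((c - m) / (u - ∫ x, g x ∂(ν : Measure E)))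
    rw [div_lt_iff₀ (sub_pos.2 hν)] at hn
    refine ⟨-n, -n * u - m, by linarith, fun μ r hr ↦ ?_⟩
    have h₁ : (n : ℝ) * u ≤ n * ∫ x, g x ∂(μ : Measure E) :=
      mul_le_mul_of_nonneg_left (hsep μ r hr).le n.cast_nonneg
    have h₂ : m ≤ r := EReal.coe_le_coe_iff.1 ((hm μ).trans hr)
    linarith
  · refine ⟨-l⁻¹, -l⁻¹ * u, ?_, fun μ r hr ↦ ?_⟩
    · have h := mul_le_mul_of_nonneg_left hν.le (inv_pos.2 hl).le
      rw [mul_add, inv_mul_cancel_left₀ hl.ne'] at h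
      linarith
    · have h := mul_le_mul_of_nonneg_left (hsep μ r hr).le (inv_pos.2 hl).le
      rw [mul_add, inv_mul_cancel_left₀ hl.ne'] at h
      linarith

/-- **Theorem 2.1** (properties of `ρ` and reconstruction of `α` from `ρ`). -/
theorem alpha_to_rho
    {E : Type*} [MeasurableSpace E] [TopologicalSpace E] [PolishSpace E] [BorelSpace E]
    [Nonempty E]
    (α : ProbabilityMeasure E → EReal)
    (hproper : ∃ ν, α ν ≠ ⊤) (hbot : ∀ ν, α ν ≠ ⊥)
    (hconvex : ∀ (μ₁ μ₂ : ProbabilityMeasure E) (t : ℝ≥0), t ≤ 1 →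
      extend α ((t : ℝ≥0∞) • (μ₁ : Measure E) + ((1 - t : ℝ≥0) : ℝ≥0∞) • (μ₂ : Measure E))
        ≤ ((t : ℝ) : EReal) * α μ₁ + (((1 - t : ℝ≥0) : ℝ) : EReal) * α μ₂)
    (hcompact : ∀ c : ℝ, IsCompact {ν : ProbabilityMeasure E | α ν ≤ (c : EReal)})
 :
    -- (R1): monotonicity
    (∀ f g : E → ℝ, Measurable f → (∃ C : ℝ, ∀ x, |f x| ≤ C) → Measurable g →
      (∃ C : ℝ, ∀ x, |g x| ≤ C) → (∀ x, g x ≤ f x) → rho α g ≤ rho α f) ∧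
    -- (R2): cash additivity
    (∀ f : E → ℝ, Measurable f → (∃ C : ℝ, ∀ x, |f x| ≤ C) → ∀ c : ℝ,
      rho α (fun x => f x + c) = rho α f + (c : EReal)) ∧
    -- (R3): continuity along nondecreasing sequences in B(E)
    (∀ (fs : ℕ → E → ℝ) (f : E → ℝ), (∀ m, Measurable (fs m)) →
      (∀ m, ∃ C : ℝ, ∀ x, |fs m x| ≤ C) → Measurable f → (∃ C : ℝ, ∀ x, |f x| ≤ C) →
      (∀ x, Monotone fun m => fs m x) →
      (∀ x, Filter.Tendsto (fun m => fs m x) Filter.atTop (𝓝 (f x))) →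
      Filter.Tendsto (fun m => rho α (fs m)) Filter.atTop (𝓝 (rho α f))) ∧
    -- (R4): continuity along nonincreasing sequences in C_b(E)
    (∀ (fs : ℕ → E → ℝ) (f : E → ℝ), (∀ m, Continuous (fs m)) →
      (∀ m, ∃ C : ℝ, ∀ x, |fs m x| ≤ C) → Measurable f → (∃ C : ℝ, ∀ x, |f x| ≤ C) →
      (∀ x, Antitone fun m => fs m x) →
      (∀ x, Filter.Tendsto (fun m => fs m x) Filter.atTop (𝓝 (f x))) →
      Filter.Tendsto (fun m => rho α (fs m)) Filter.atTop (𝓝 (rho α f))) ∧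
    -- reconstruction of `α` from `ρ` using only continuous bounded functions
    (∀ ν : ProbabilityMeasure E,
      α ν = ⨆ (f : E → ℝ) (_ : Continuous f) (_ : ∃ C : ℝ, ∀ x, |f x| ≤ C),
        ((∫ x, f x ∂(ν : Measure E) : ℝ) : EReal) - rho α f) := by
  refine ⟨fun f g hf hfb hg hgb h ↦ rho_mono α hf hfb hg hgb h,
    fun f hf hfb c ↦ rho_add_const α hf hfb c,
    fun fs f hfs hfsb hf hfb hmono hlim ↦
      tendsto_rho_of_monotone α hbot hfs hfsb hf hfb hmono hlim,
    fun fs f hfs hfsb hf hfb hanti hlim ↦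
      tendsto_rho_of_antitone hbot hcompact hfs hfsb hf hfb hanti hlim,
    fun ν ↦ le_antisymm (EReal.ge_of_forall_gt_iff_ge.1 fun c hc ↦ ?_)
      (iSup_le fun f ↦ iSup_le fun hf ↦ iSup_le fun hfb ↦ ?_)⟩
  · obtain ⟨f, hf⟩ := exists_coe_le_integral_sub_rho hproper hbot hconvex hcompact hc
    exact hf.trans (le_iSup₂_of_le (f : E → ℝ) f.continuous
      (le_iSup_of_le ⟨‖f‖, f.norm_coe_le_norm⟩ le_rfl))
  · by_cases hν : α ν = ⊤
    · exact hν ▸ le_top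
    refine EReal.sub_le_of_le_add' ?_
    exact (EReal.sub_le_iff_le_add (.inl (hbot ν)) (.inl hν)).1
      (le_iSup (fun μ : ProbabilityMeasure E ↦
        ((∫ x, f x ∂(μ : Measure E) : ℝ) : EReal) - α μ) ν)

end SanovDual
end
end

section
/- Suppose ρ : B(E) → ℝ is convex and satisfies: (R1) f ≥ g pointwise implies ρ(f) ≥ ρ(g); (R2) ρ(f + c) = ρ(f) + c for all f ∈ B(E), c ∈ ℝ; (R3) if f_n ∈ B(E) increase pointwise to f ∈ B(E) then ρ(f_n) ↑ ρ(f); (R4) if f_n ∈ C_b(E) decrease pointwise to f ∈ B(E) then ρ(f_n) ↓ ρ(f). Define α(ν) = sup_{f ∈ C_b(E)} (∫ f dν − ρ(f)) for ν ∈ P(E). Then α is convex with weakly compact sub-level sets, and ρ(f) = sup_{ν ∈ P(E)} (∫ f dν − α(ν)) for every f ∈ B(E). -/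
open MeasureTheory ProbabilityTheory Filter Topology Set
open scoped ENNReal NNReal

noncomputable section

namespace SanovDual

attribute [local instance] Classical.propDecidable

/-- The penalty function `α` built from a functional `ρ` via continuous bounded test functions. -/
def dualAlpha {E : Type*} [MeasurableSpace E] [TopologicalSpace E] (ρ : (E → ℝ) → ℝ)
    (ν : ProbabilityMeasure E) : EReal :=
  ⨆ (f : E → ℝ) (_ : Continuous f) (_ : ∃ C : ℝ, ∀ x, |f x| ≤ C),
    ((∫ x, f x ∂(ν : Measure E) : ℝ) : EReal) - (ρ f : EReal)

open scoped BoundedContinuousFunction CompactlySupported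

/-- In a complete space, an ultrafilter containing finite unions of arbitrarily small balls
converges. -/
lemma exists_le_nhds_of_forall_finite_closedBall {X : Type*} [PseudoMetricSpace X]
    [CompleteSpace X] (F : Ultrafilter X)
    (h : ∀ ε > 0, ∃ s : Set X, s.Finite ∧ (⋃ z ∈ s, Metric.closedBall z ε) ∈ F) :
    ∃ x, (F : Filter X) ≤ 𝓝 x := by
  refine CompleteSpace.complete (Metric.cauchy_iff.2 ⟨F.neBot, fun ε hε => ?_⟩)
  obtain ⟨s, hs, hF⟩ := h (ε / 3) (by positivity)
  obtain ⟨z, -, hz⟩ := (Ultrafilter.finite_biUnion_mem_iff hs).1 hF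
  refine ⟨_, hz, fun x hx y hy => ?_⟩
  have := dist_triangle_right x y z
  rw [Metric.mem_closedBall] at hx hy
  linarith

/-- A real-valued convex function on a real vector space has a subgradient at every point. -/
lemma exists_subgradient {V : Type*} [AddCommGroup V] [Module ℝ V] {φ : V → ℝ}
    (hφ : ConvexOn ℝ univ φ) (x₀ : V) :
    ∃ ℓ : V →ₗ[ℝ] ℝ, ∀ v, φ x₀ + ℓ v ≤ φ (x₀ + v) := by
  set q : V → Ioi (0 : ℝ) → ℝ := fun v t => (φ (x₀ + (t : ℝ) • v) - φ x₀) / t with hq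
  have key : ∀ (v w : V) (s t : ℝ), 0 < s → 0 < t →
      φ (x₀ + (s * t / (s + t)) • (v + w)) - φ x₀ ≤
        t / (s + t) * (φ (x₀ + s • v) - φ x₀) + s / (s + t) * (φ (x₀ + t • w) - φ x₀) := by
    intro v w s t hs ht
    have hst : t / (s + t) + s / (s + t) = 1 := by field_simp; ring
    have h := hφ.2 (mem_univ (x₀ + s • v)) (mem_univ (x₀ + t • w))
      (show 0 ≤ t / (s + t) by positivity) (show 0 ≤ s / (s + t) by positivity) hst
    have e : (t / (s + t)) • (x₀ + s • v) + (s / (s + t)) • (x₀ + t • w)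
        = x₀ + (s * t / (s + t)) • (v + w) := by
      have h1 : x₀ = (t / (s + t)) • x₀ + (s / (s + t)) • x₀ := by
        rw [← add_smul, hst, one_smul]
      conv_rhs => rw [h1]
      simp only [smul_add, smul_smul]
      rw [show t / (s + t) * s = s * t / (s + t) by ring,
        show s / (s + t) * t = s * t / (s + t) by ring]
      abel
    rw [e] at h
    simp only [smul_eq_mul] at h
    have : φ x₀ = t / (s + t) * φ x₀ + s / (s + t) * φ x₀ := by rw [← add_mul, hst, one_mul]
    linarith
  have key' : ∀ (v w : V) (s t : Ioi (0 : ℝ)), ∃ r, q (v + w) r ≤ q v s + q w t := by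
    rintro v w ⟨s, hs⟩ ⟨t, ht⟩
    rw [mem_Ioi] at hs ht
    refine ⟨⟨s * t / (s + t), by rw [mem_Ioi]; positivity⟩, ?_⟩
    have := key v w s t hs ht
    simp only [hq]
    rw [div_le_iff₀ (by positivity)]
    refine this.trans (le_of_eq ?_)
    field_simp
  have hbdd : ∀ v, BddBelow (range (q v)) := by
    intro v
    refine ⟨-q (-v) ⟨1, mem_Ioi.2 one_pos⟩, ?_⟩
    rintro _ ⟨t, rfl⟩
    obtain ⟨r, hr⟩ := key' v (-v) t ⟨1, mem_Ioi.2 one_pos⟩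
    have : q (v + -v) r = 0 := by simp [hq]
    linarith
  obtain ⟨ℓ, -, hℓ⟩ : ∃ ℓ : V →ₗ[ℝ] ℝ, (∀ x : (⊥ : V →ₗ.[ℝ] ℝ).domain, ℓ x = (⊥ : V →ₗ.[ℝ] ℝ) x) ∧
      ∀ v, ℓ v ≤ ⨅ t, q v t := by
    refine exists_extension_of_le_sublinear _ _ ?_ ?_ ?_
    · intro c hc v
      rw [Real.mul_iInf_of_nonneg hc.le]
      have e : ∀ t : Ioi (0 : ℝ), q (c • v) t
          = c * q v ⟨c * t, mul_pos hc t.2⟩ := by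
        rintro ⟨t, ht⟩
        rw [mem_Ioi] at ht
        simp only [hq, smul_smul, mul_comm t c]
        field_simp
      simp only [e]
      refine Function.Surjective.iInf_comp
        (f := fun t : Ioi (0 : ℝ) => (⟨c * t, mul_pos hc t.2⟩ : Ioi (0 : ℝ)))
        ?_ (fun t => c * q v t)
      rintro ⟨t, ht⟩
      refine ⟨⟨t / c, div_pos ht hc⟩, Subtype.ext ?_⟩
      simp only
      field_simp
    · intro v w
      refine le_ciInf_add_ciInf fun s t => ?_
      obtain ⟨r, hr⟩ := key' v w s t
      exact (ciInf_le (hbdd _) r).trans hr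
    · rintro ⟨x, hx⟩
      obtain rfl : x = 0 := (Submodule.mem_bot ℝ).1 hx
      have : (fun t : Ioi (0 : ℝ) => q 0 t) = fun _ => 0 := by ext t; simp [hq]
      simp only [this, ciInf_const]
      exact le_of_eq (LinearPMap.map_zero _)
  refine ⟨ℓ, fun v => ?_⟩
  have h1 := (hℓ v).trans (ciInf_le (hbdd v) ⟨1, mem_Ioi.2 one_pos⟩)
  simp only [hq, one_smul, div_one] at h1
  linarith

/-- A bounded continuous function extends continuously to the Stone–Čech compactification. -/
lemma exists_stoneCech_extension {E : Type*} [TopologicalSpace E] (u : E →ᵇ ℝ) :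
    ∃ v : C(StoneCech E, ℝ), ∀ x, v (stoneCechUnit x) = u x := by
  have hc : Continuous (fun x => (⟨u x, by
      have := u.norm_coe_le_norm x
      rwa [Real.norm_eq_abs, abs_le] at this⟩ : Icc (-‖u‖) ‖u‖)) :=
    u.continuous.subtype_mk _
  refine ⟨⟨fun x => (stoneCechExtend hc x).1,
    continuous_subtype_val.comp (continuous_stoneCechExtend hc)⟩, fun x => ?_⟩
  simp [stoneCechExtend_stoneCechUnit]

/-- Bounded continuous functions decreasing to zero, vanishing near a dense sequence. -/
lemma exists_antitone_tendsto_zero (E : Type*) [MetricSpace E]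
    [TopologicalSpace.SeparableSpace E] [Nonempty E] {ε : ℝ} (hε : 0 < ε) :
    ∃ u : ℕ → E →ᵇ ℝ, (∀ n x, 0 ≤ u n x) ∧ (∀ x, Antitone fun n => u n x) ∧
      (∀ x, Tendsto (fun n => u n x) atTop (𝓝 0)) ∧
      ∀ n, ∃ s : Set E, s.Finite ∧ {x | u n x < 1} ⊆ ⋃ z ∈ s, Metric.closedBall z ε := by
  set S : ℕ → Set E := fun n => TopologicalSpace.denseSeq E '' Iic n with hS
  have hne : ∀ n, (S n).Nonempty := fun n => ⟨_, 0, by simp, rfl⟩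
  have hmono : ∀ x, Antitone fun n => Metric.infDist x (S n) := fun x m n hmn =>
    Metric.infDist_le_infDist_of_subset (image_mono (Iic_subset_Iic.2 hmn)) (hne m)
  refine ⟨fun n => BoundedContinuousFunction.ofNormedAddCommGroup
    (fun x => min 1 (max 0 (2 * Metric.infDist x (S n) / ε - 1))) ?_ 1 ?_, ?_, ?_, ?_, ?_⟩
  · have := Metric.continuous_infDist_pt (S n)
    fun_prop
  · intro x
    rw [Real.norm_eq_abs, abs_of_nonneg (by positivity)]
    exact min_le_left _ _
  · intro n x
    simp only [BoundedContinuousFunction.coe_ofNormedAddCommGroup]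
    positivity
  · intro x m n hmn
    simp only [BoundedContinuousFunction.coe_ofNormedAddCommGroup]
    have := hmono x hmn
    gcongr
  · intro x
    obtain ⟨y, hy, k, rfl⟩ := Metric.dense_iff.1
      (TopologicalSpace.denseRange_denseSeq E) x (ε / 2) (by positivity)
    refine tendsto_const_nhds.congr' ?_
    filter_upwards [eventually_ge_atTop k] with n hn
    simp only [BoundedContinuousFunction.coe_ofNormedAddCommGroup]
    have h1 : Metric.infDist x (S n) ≤ ε / 2 :=
      (Metric.infDist_le_dist_of_mem (mem_image_of_mem _ (mem_Iic.2 hn))).trans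
        (by rw [dist_comm]; exact (Metric.mem_ball.1 hy).le)
    have h2 : 2 * Metric.infDist x (S n) / ε - 1 ≤ 0 := by
      rw [sub_nonpos, div_le_one hε]; linarith
    rw [max_eq_left h2]; simp
  · refine fun n => ⟨S n, (finite_Iic n).image _, fun x hx => ?_⟩
    simp only [BoundedContinuousFunction.coe_ofNormedAddCommGroup, Set.mem_ofPred_eq,
      min_lt_iff, lt_irrefl, false_or, max_lt_iff, zero_lt_one, true_and] at hx
    have h1 : Metric.infDist x (S n) < ε := by
      rw [sub_lt_iff_lt_add, div_lt_iff₀ hε] at hx; linarith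
    obtain ⟨z, hz, hxz⟩ := (Metric.infDist_lt_iff (hne n)).1 h1
    exact mem_biUnion hz hxz.le

/-- **Daniell–Stone** on Polish spaces: a positive normalized linear functional on bounded
continuous functions which is continuous along sequences decreasing to zero is the integral
against a probability measure. -/
theorem exists_probabilityMeasure_of_linear {E : Type*} [MeasurableSpace E] [TopologicalSpace E]
    [PolishSpace E] [BorelSpace E] [Nonempty E] (ℓ : (E →ᵇ ℝ) →ₗ[ℝ] ℝ)
    (hpos : ∀ u : E →ᵇ ℝ, (∀ x, 0 ≤ u x) → 0 ≤ ℓ u) (hone : ℓ 1 = 1)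
    (hcont : ∀ u : ℕ → E →ᵇ ℝ, (∀ x, Antitone fun n => u n x) →
      (∀ x, Tendsto (fun n => u n x) atTop (𝓝 0)) → Tendsto (fun n => ℓ (u n)) atTop (𝓝 0)) :
    ∃ ν : ProbabilityMeasure E, ∀ u : E →ᵇ ℝ, ∫ x, u x ∂(ν : Measure E) = ℓ u := by
  let := TopologicalSpace.upgradeIsCompletelyMetrizable E
  let : MeasurableSpace (StoneCech E) := borel _
  have : BorelSpace (StoneCech E) := ⟨rfl⟩
  let ι : C(E, StoneCech E) := ⟨stoneCechUnit, continuous_stoneCechUnit⟩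
  have hmonoℓ : ∀ u v : E →ᵇ ℝ, (∀ x, u x ≤ v x) → ℓ u ≤ ℓ v := fun u v h => by
    have := hpos (v - u) fun x => by simpa using h x
    rw [map_sub] at this
    linarith
  let Λ : C_c(StoneCech E, ℝ) →ₚ[ℝ] ℝ :=
    { toFun := fun g => ℓ (g.toBoundedContinuousFunction.compContinuous ι)
      map_add' := fun g h => by rw [← map_add]; rfl
      map_smul' := fun c g => by rw [← map_smul]; rfl
      monotone' := fun g h hgh => hmonoℓ _ _ fun x => hgh (ι x) }
  set μ := RealRMK.rieszMeasure Λ with hμ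
  have hint : ∀ (u : E →ᵇ ℝ) (v : C(StoneCech E, ℝ)), (∀ x, v (ι x) = u x) →
      ∫ y, v y ∂μ = ℓ u := by
    intro u v huv
    have := RealRMK.integral_rieszMeasure Λ ⟨v, HasCompactSupport.of_compactSpace v⟩
    refine Eq.trans this (congrArg ℓ ?_)
    ext x
    exact huv x
  have hμ1 : IsProbabilityMeasure μ := by
    have h := hint 1 1 fun x => rfl
    simp only [ContinuousMap.one_apply, integral_const, smul_eq_mul, mul_one, hone] at h
    exact ⟨by rwa [Measure.real, ENNReal.toReal_eq_one_iff] at h⟩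
  choose ext hext using fun u : E →ᵇ ℝ => exists_stoneCech_extension u
  choose u hu0 humono hulim hufin using fun k : ℕ =>
    exists_antitone_tendsto_zero E (ε := 1 / ((k : ℝ) + 1)) (by positivity)
  have hext0 : ∀ k n y, 0 ≤ ext (u k n) y := by
    intro k n
    have hcl : IsClosed {y | 0 ≤ ext (u k n) y} :=
      isClosed_le continuous_const (ext (u k n)).continuous
    intro y
    refine denseRange_stoneCechUnit.induction_on y hcl fun x => ?_
    rw [hext]
    exact hu0 k n x
  have hrange : range ι = ⋂ k, ⋃ n, {y | ext (u k n) y < 1} := by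
    apply Subset.antisymm
    · rintro _ ⟨x, rfl⟩
      refine mem_iInter.2 fun k => mem_iUnion.2 ?_
      obtain ⟨n, hn⟩ := ((hulim k x).eventually_lt_const one_pos).exists
      exact ⟨n, by rw [Set.mem_ofPred_eq]; exact (hext _ _).trans_lt hn⟩
    · intro y hy
      have : (comap ι (𝓝 y)).NeBot :=
        isDenseInducing_stoneCechUnit.comap_nhds_neBot y
      set F := Ultrafilter.of (comap ι (𝓝 y)) with hF
      have hFle : (F : Filter E) ≤ comap ι (𝓝 y) := Ultrafilter.of_le _
      obtain ⟨x, hx⟩ := exists_le_nhds_of_forall_finite_closedBall F fun ε hε => by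
        obtain ⟨k, hk⟩ := exists_nat_one_div_lt hε
        obtain ⟨n, hn⟩ := mem_iUnion.1 (mem_iInter.1 hy k)
        obtain ⟨s, hs, hsub⟩ := hufin k n
        refine ⟨s, hs, mem_of_superset (x := {x | u k n x < 1}) ?_ ?_⟩
        · refine hFle ⟨{y | ext (u k n) y < 1},
            (isOpen_lt (ext (u k n)).continuous continuous_const).mem_nhds hn, fun x hx => ?_⟩
          exact (hext (u k n) x).symm.trans_lt hx
        · exact hsub.trans (iUnion₂_mono fun z _ => Metric.closedBall_subset_closedBall hk.le)
      refine ⟨x, tendsto_nhds_unique (f := ι) (l := F) ?_ ?_⟩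
      · exact (ι.continuous.tendsto x).mono_left hx
      · exact tendsto_comap.mono_left hFle
  have hmeas : MeasurableSet (range ι) := by
    rw [hrange]
    exact .iInter fun k => .iUnion fun n =>
      (isOpen_lt (ext (u k n)).continuous continuous_const).measurableSet
  have hemb : MeasurableEmbedding ι := isEmbedding_stoneCechUnit.measurableEmbedding hmeas
  have hnull : μ (range ι)ᶜ = 0 := by
    rw [hrange]
    simp only [compl_iInter, compl_iUnion]
    refine measure_iUnion_null fun k => ?_
    have hle : ∀ n, μ.real (⋂ n, {y | ext (u k n) y < 1}ᶜ) ≤ ℓ (u k n) := by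
      intro n
      have h1 := mul_meas_ge_le_integral_of_nonneg (μ := μ) (f := ext (u k n))
        (ae_of_all _ (hext0 k n))
        ((ext (u k n)).continuous.integrable_of_hasCompactSupport
          (HasCompactSupport.of_compactSpace _)) 1
      rw [hint _ _ (hext (u k n)), one_mul] at h1
      refine (measureReal_mono (iInter_subset _ n)).trans (le_trans (le_of_eq ?_) h1)
      congr 1
      ext y
      simp
    have h0 := ge_of_tendsto' (hcont (u k) (humono k) (hulim k)) hle
    exact (measureReal_eq_zero_iff).1 (le_antisymm h0 measureReal_nonneg)
  have hmap : (μ.comap ι).map ι = μ := by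
    rw [hemb.map_comap, Measure.restrict_eq_self_of_ae_mem]
    exact hnull
  have hν : IsProbabilityMeasure (μ.comap ι) := by
    refine ⟨?_⟩
    rw [← preimage_univ (f := ι), ← hemb.map_apply, hmap, measure_univ]
  refine ⟨⟨μ.comap ι, hν⟩, fun v => ?_⟩
  have h : ∫ y, ext v y ∂((μ.comap ι).map ι) = ∫ x, ext v (ι x) ∂(μ.comap ι) :=
    hemb.integral_map _
  rw [hmap, hint v (ext v) (hext v)] at h
  rw [h]
  exact integral_congr_ae (ae_of_all _ fun x => (hext v x).symm)

/-- Sup-convolution: bounded functions decreasing pointwise, with total boundedness of the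
relevant points, are dominated by bounded continuous functions with the right limit. -/
lemma exists_continuous_antitone {E : Type*} [MetricSpace E] [Nonempty E] {C : ℝ}
    (F : ℕ → E → ℝ) (hF : ∀ n x, |F n x| ≤ C) (hanti : ∀ x, Antitone fun n => F n x) :
    ∃ h : ℕ → E → ℝ, (∀ n, Continuous (h n)) ∧ (∀ n x, |h n x| ≤ C) ∧
      (∀ x, Antitone fun n => h n x) ∧ (∀ n x, F n x ≤ h n x) ∧
      ∀ n x a, a < h n x → ∃ y, a + n * dist x y < F n y := by
  have hbdd : ∀ n x, BddAbove (range fun y => F n y - n * dist x y) := by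
    intro n x
    refine ⟨C, ?_⟩
    rintro _ ⟨y, rfl⟩
    have := (abs_le.1 (hF n y)).2
    have : 0 ≤ n * dist x y := by positivity
    dsimp only
    linarith
  have hle : ∀ n x, F n x ≤ ⨆ y, (F n y - n * dist x y) := fun n x => by
    simpa using le_ciSup (hbdd n x) x
  refine ⟨fun n x => ⨆ y, (F n y - n * dist x y), fun n => ?_, fun n x => ?_, fun x m n hmn => ?_,
    hle, fun n x a ha => ?_⟩
  · refine (LipschitzWith.of_le_add_mul (n : ℝ≥0) fun x z => ciSup_le fun y => ?_).continuous
    have h1 := le_ciSup (hbdd n z) y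
    have h2 : (n : ℝ) * dist z y ≤ n * (dist x z + dist x y) := by
      gcongr
      exact dist_triangle_left z y x
    simp only [NNReal.coe_natCast]
    linarith
  · refine abs_le.2 ⟨(abs_le.1 (hF n x)).1.trans (hle n x), ciSup_le fun y => ?_⟩
    have := (abs_le.1 (hF n y)).2
    have : 0 ≤ n * dist x y := by positivity
    linarith
  · refine ciSup_mono (hbdd m x) fun y => ?_
    have := hanti y hmn
    dsimp only at this ⊢
    gcongr
  · obtain ⟨y, hy⟩ := exists_lt_of_lt_ciSup ha
    exact ⟨y, by linarith⟩

/-- **Choquet capacitability**, in a form suited to monotone functionals: a functional on bounded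
measurable functions that is continuous along increasing sequences is approximated from inside at
`f` by limits of decreasing sequences of bounded continuous functions. -/
lemma exists_continuous_antitone_approx_of_continuous {X E : Type*} [MetricSpace X]
    [CompleteSpace X] [SecondCountableTopology X] [Nonempty X] [MeasurableSpace E] [MetricSpace E]
    [BorelSpace E] [SecondCountableTopology E] (i : X ≃ E) (hi : Continuous i) (Φ : (E → ℝ) → ℝ)
    (hmono : ∀ f g : E → ℝ, Measurable f → (∃ C : ℝ, ∀ x, |f x| ≤ C) → Measurable g →
      (∃ C : ℝ, ∀ x, |g x| ≤ C) → (∀ x, g x ≤ f x) → Φ g ≤ Φ f)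
    (hcont : ∀ (fs : ℕ → E → ℝ) (f : E → ℝ), (∀ m, Measurable (fs m)) →
      (∀ m, ∃ C : ℝ, ∀ x, |fs m x| ≤ C) → Measurable f → (∃ C : ℝ, ∀ x, |f x| ≤ C) →
      (∀ x, Monotone fun m => fs m x) →
      (∀ x, Filter.Tendsto (fun m => fs m x) Filter.atTop (𝓝 (f x))) →
      Filter.Tendsto (fun m => Φ (fs m)) Filter.atTop (𝓝 (Φ f)))
    {f : E → ℝ} (hf : Continuous (f ∘ i)) (hfm : Measurable f) {C : ℝ} (hC : ∀ x, |f x| ≤ C)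
    {c : ℝ} (hc : c < Φ f) :
    ∃ (h : ℕ → E → ℝ) (g : E → ℝ), (∀ n, Continuous (h n)) ∧ (∀ n x, |h n x| ≤ C) ∧
      Measurable g ∧ (∀ x, |g x| ≤ C) ∧ (∀ x, Antitone fun n => h n x) ∧
      (∀ x, Tendsto (fun n => h n x) atTop (𝓝 (g x))) ∧ (∀ x, g x ≤ f x) ∧
      ∀ n, c ≤ Φ (h n) := by
  have : Nonempty E := i.nonempty_congr.1 inferInstance
  have hC0 : 0 ≤ C := (abs_nonneg _).trans (hC (Classical.arbitrary E))
  set T : Set E → E → ℝ := fun A => A.piecewise f fun _ => -C with hT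
  have hTmem : ∀ {A : Set E} {x}, x ∈ A → T A x = f x := fun h => by simp [hT, h]
  have hTnot : ∀ {A : Set E} {x}, x ∉ A → T A x = -C := fun h => by simp [hT, h]
  have hTabs : ∀ A x, |T A x| ≤ C := fun A x => by
    by_cases hx : x ∈ A
    · rw [hTmem hx]; exact hC x
    · rw [hTnot hx, abs_neg, abs_of_nonneg hC0]
  have hTmono : ∀ {A B : Set E}, A ⊆ B → ∀ x, T A x ≤ T B x := fun {A B} hAB x => by
    by_cases hx : x ∈ A
    · rw [hTmem hx, hTmem (hAB hx)]
    · rw [hTnot hx]; exact (abs_le.1 (hTabs B x)).1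
  have hTmeas : ∀ {A : Set E}, MeasurableSet A → Measurable (T A) := fun hA =>
    hfm.piecewise hA measurable_const
  -- the sets covered by finitely many balls of `X`
  set B : ℕ → ℕ → Set E := fun k n =>
    ⋃ j ∈ Iic n, i '' Metric.closedBall (TopologicalSpace.denseSeq X j) (1 / ((k : ℝ) + 1)) with hB
  have hBmeas : ∀ k n, MeasurableSet (B k n) := by
    intro k n
    let : MeasurableSpace X := borel X
    have : BorelSpace X := ⟨rfl⟩
    refine (finite_Iic n).measurableSet_biUnion fun j _ => ?_
    exact Metric.isClosed_closedBall.measurableSet.image_of_continuousOn_injOn hi.continuousOn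
      i.injective.injOn
  have hBmono : ∀ k, Monotone (B k) := fun k m n hmn =>
    biUnion_subset_biUnion_left (Iic_subset_Iic.2 hmn)
  have hBcov : ∀ k x, ∃ n, x ∈ B k n := by
    intro k x
    obtain ⟨y, hy, n, rfl⟩ := Metric.dense_iff.1 (TopologicalSpace.denseRange_denseSeq X)
      (i.symm x) (1 / ((k : ℝ) + 1)) (by positivity)
    refine ⟨n, mem_biUnion (mem_Iic.2 le_rfl) ⟨i.symm x, ?_, by simp⟩⟩
    rw [Metric.mem_closedBall, dist_comm]
    exact (Metric.mem_ball.1 hy).le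
  have hstep : ∀ (k : ℕ) (A : {A : Set E // MeasurableSet A ∧ c < Φ (T A)}),
      ∃ A' : {A : Set E // MeasurableSet A ∧ c < Φ (T A)}, A'.1 ⊆ A.1 ∧ ∃ n, A'.1 ⊆ B k n := by
    rintro k ⟨A, hA, hcA⟩
    have hlim := hcont (fun n => T (A ∩ B k n)) (T A) (fun n => hTmeas (hA.inter (hBmeas k n)))
      (fun n => ⟨C, hTabs _⟩) (hTmeas hA) ⟨C, hTabs _⟩
      (fun x m n hmn => hTmono (inter_subset_inter_right A (hBmono k hmn)) x) (fun x => by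
        obtain ⟨n, hn⟩ := hBcov k x
        refine tendsto_const_nhds.congr' ?_
        filter_upwards [eventually_ge_atTop n] with m hm
        have hx := hBmono k hm hn
        by_cases hxA : x ∈ A
        · rw [hTmem hxA, hTmem (mem_inter hxA hx)]
        · rw [hTnot hxA, hTnot fun h => hxA h.1])
    obtain ⟨n, hn⟩ := (hlim.eventually_const_lt hcA).exists
    exact ⟨⟨A ∩ B k n, hA.inter (hBmeas k n), hn⟩, inter_subset_left, n, inter_subset_right⟩
  choose next hnext1 hnext2 using hstep
  have huniv : T univ = f := by ext x; exact hTmem (mem_univ x)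
  let A : ℕ → {A : Set E // MeasurableSet A ∧ c < Φ (T A)} :=
    fun n => Nat.rec ⟨univ, MeasurableSet.univ, by rwa [huniv]⟩ (fun k A => next k A) n
  have hAanti : Antitone fun n => (A n).1 := antitone_nat_of_succ_le fun n => hnext1 n (A n)
  obtain ⟨h, hhc, hhC, hhanti, hFh, hhlt⟩ := exists_continuous_antitone (fun n => T (A n).1)
    (fun n => hTabs _) (fun x m n hmn => hTmono (hAanti hmn) x)
  have hlim : ∀ x, ∃ l, Tendsto (fun n => h n x) atTop (𝓝 l) := fun x =>
    ⟨_, tendsto_atTop_ciInf (hhanti x) ⟨-C, by rintro _ ⟨n, rfl⟩; exact (abs_le.1 (hhC n x)).1⟩⟩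
  choose g hg using hlim
  refine ⟨h, g, hhc, hhC, measurable_of_tendsto_metrizable (fun n => (hhc n).measurable)
    (tendsto_pi_nhds.2 hg), fun x => le_of_tendsto' (hg x).abs fun n => hhC n x, hhanti, hg,
    fun x => ?_, fun n => ?_⟩
  · by_contra! hlt
    obtain ⟨a, hfa, hag⟩ := exists_between hlt
    have haC : -C < a := ((abs_le.1 (hC x)).1).trans_lt hfa
    have hah : ∀ n, a < h n x := fun n => hag.trans_le ((hhanti x).le_of_tendsto (hg x) n)
    choose y hy using fun n => hhlt n x a (hah n)
    have hay : ∀ n, a < T (A n).1 (y n) := fun n => by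
      have : 0 ≤ n * dist x (y n) := by positivity
      linarith [hy n]
    have hyA : ∀ n, y n ∈ (A n).1 := fun n => by
      by_contra hn
      have := hay n
      rw [hTnot hn] at this
      linarith
    have hyx : Tendsto y atTop (𝓝 x) := by
      rw [tendsto_iff_dist_tendsto_zero]
      refine squeeze_zero' (g := fun n : ℕ => 2 * C / n) (Eventually.of_forall fun _ => dist_nonneg)
        ?_ (tendsto_const_div_atTop_nhds_zero_nat _)
      filter_upwards [eventually_gt_atTop 0] with n hn
      rw [le_div_iff₀ (by positivity), dist_comm, mul_comm]
      have := (abs_le.1 (hTabs (A n).1 (y n))).2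
      linarith [hy n]
    set U : Ultrafilter X := (Ultrafilter.of (atTop : Filter ℕ)).map (i.symm ∘ y) with hU
    have hUle : (U : Filter X) ≤ map (i.symm ∘ y) atTop := by
      rw [hU, Ultrafilter.coe_map]
      exact map_mono (Ultrafilter.of_le _)
    obtain ⟨z, hz⟩ := exists_le_nhds_of_forall_finite_closedBall U fun ε hε => by
      obtain ⟨k, hk⟩ := exists_nat_one_div_lt hε
      obtain ⟨n, hn⟩ := hnext2 k (A k)
      refine ⟨TopologicalSpace.denseSeq X '' Iic n, (finite_Iic n).image _, hUle ?_⟩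
      rw [mem_map]
      filter_upwards [eventually_ge_atTop (k + 1)] with m hm
      have h1 : y m ∈ B k n := hn (hAanti hm (hyA m))
      simp only [hB, mem_iUnion] at h1
      obtain ⟨j, hj, w, hw, hwy⟩ := h1
      refine mem_biUnion (mem_image_of_mem _ hj) ?_
      rw [Function.comp_apply, ← hwy, Equiv.symm_apply_apply]
      exact Metric.closedBall_subset_closedBall hk.le hw
    have hUx : Tendsto i U (𝓝 x) := by
      refine Tendsto.mono_left ?_ hUle
      rw [tendsto_map'_iff]
      simpa [Function.comp_def] using hyx
    have hiz : i z = x := tendsto_nhds_unique ((hi.tendsto z).mono_left hz) hUx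
    have hfz : a ≤ f (i z) := by
      refine ge_of_tendsto ((hf.tendsto z).mono_left hz) (hUle ?_)
      refine mem_map.2 (Eventually.of_forall fun n => ?_)
      have := hay n
      rw [hTmem (hyA n)] at this
      simpa using this.le
    rw [hiz] at hfz
    linarith
  · exact (A n).2.2.le.trans (hmono _ _ (hhc n).measurable ⟨C, hhC n⟩ (hTmeas (A n).2.1)
      ⟨C, hTabs _⟩ (hFh n))

/-- **Choquet capacitability** for monotone functionals on the bounded Borel functions of a
Polish space. -/
theorem exists_continuous_antitone_approx {E : Type*} [MeasurableSpace E] [TopologicalSpace E]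
    [PolishSpace E] [BorelSpace E] [Nonempty E] (Φ : (E → ℝ) → ℝ)
    (hmono : ∀ f g : E → ℝ, Measurable f → (∃ C : ℝ, ∀ x, |f x| ≤ C) → Measurable g →
      (∃ C : ℝ, ∀ x, |g x| ≤ C) → (∀ x, g x ≤ f x) → Φ g ≤ Φ f)
    (hcont : ∀ (fs : ℕ → E → ℝ) (f : E → ℝ), (∀ m, Measurable (fs m)) →
      (∀ m, ∃ C : ℝ, ∀ x, |fs m x| ≤ C) → Measurable f → (∃ C : ℝ, ∀ x, |f x| ≤ C) →
      (∀ x, Monotone fun m => fs m x) →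
      (∀ x, Filter.Tendsto (fun m => fs m x) Filter.atTop (𝓝 (f x))) →
      Filter.Tendsto (fun m => Φ (fs m)) Filter.atTop (𝓝 (Φ f)))
    {f : E → ℝ} (hfm : Measurable f) {C : ℝ} (hC : ∀ x, |f x| ≤ C) {c : ℝ} (hc : c < Φ f) :
    ∃ (h : ℕ → E → ℝ) (g : E → ℝ), (∀ n, Continuous (h n)) ∧ (∀ n x, |h n x| ≤ C) ∧
      Measurable g ∧ (∀ x, |g x| ≤ C) ∧ (∀ x, Antitone fun n => h n x) ∧
      (∀ x, Tendsto (fun n => h n x) atTop (𝓝 (g x))) ∧ (∀ x, g x ≤ f x) ∧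
      ∀ n, c ≤ Φ (h n) := by
  let m := TopologicalSpace.upgradeIsCompletelyMetrizable E
  obtain ⟨t', ht', hf, hpol⟩ := hfm.exists_continuous
  let mX : MetricSpace E := @TopologicalSpace.completelyMetrizableMetric E t' _
  have hX : @CompleteSpace E mX.toUniformSpace :=
    @TopologicalSpace.complete_completelyMetrizableMetric E t' _
  exact @exists_continuous_antitone_approx_of_continuous E E mX hX
    (@PolishSpace.toSecondCountableTopology E t' hpol) inferInstance _ m.toMetricSpace _ _
    (Equiv.refl E) (continuous_id_of_le ht') Φ hmono hcont f hf hfm C hC c hc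

lemma integrable_of_abs_le {X : Type*} [MeasurableSpace X] {μ : Measure X} [IsFiniteMeasure μ]
    {f : X → ℝ} (hf : Measurable f) {C : ℝ} (hC : ∀ x, |f x| ≤ C) : Integrable f μ :=
  .of_bound hf.aestronglyMeasurable C (ae_of_all _ hC)

section Duality

variable {E : Type*} [MeasurableSpace E] [TopologicalSpace E] {ρ : (E → ℝ) → ℝ}

lemma dualAlpha_le_coe_iff {ν : ProbabilityMeasure E} {c : ℝ} :
    dualAlpha ρ ν ≤ (c : EReal) ↔ ∀ u : E →ᵇ ℝ, ∫ x, u x ∂(ν : Measure E) - ρ u ≤ c := by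
  simp only [dualAlpha, iSup_le_iff, ← EReal.coe_sub, EReal.coe_le_coe_iff]
  refine ⟨fun h u => h u u.continuous ⟨‖u‖, u.norm_coe_le_norm⟩, ?_⟩
  rintro h f hf ⟨C, hC⟩
  exact h (BoundedContinuousFunction.ofNormedAddCommGroup f hf C hC)

lemma coe_sub_le_dualAlpha {ν : ProbabilityMeasure E} {f : E → ℝ} (hf : Continuous f)
    (hb : ∃ C : ℝ, ∀ x, |f x| ≤ C) :
    ((∫ x, f x ∂(ν : Measure E) - ρ f : ℝ) : EReal) ≤ dualAlpha ρ ν := by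
  rw [EReal.coe_sub]
  exact le_iSup_of_le f (le_iSup_of_le hf (le_iSup_of_le hb le_rfl))

/-- `dualAlpha ρ` is convex. -/
lemma extend_dualAlpha_convex [OpensMeasurableSpace E] (μ₁ μ₂ : ProbabilityMeasure E) {t : ℝ≥0}
    (ht : t ≤ 1) :
    extend (dualAlpha ρ) ((t : ℝ≥0∞) • (μ₁ : Measure E) +
        ((1 - t : ℝ≥0) : ℝ≥0∞) • (μ₂ : Measure E))
      ≤ ((t : ℝ) : EReal) * dualAlpha ρ μ₁ +
        (((1 - t : ℝ≥0) : ℝ) : EReal) * dualAlpha ρ μ₂ := by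
  have hsum : (t : ℝ) + ((1 - t : ℝ≥0) : ℝ) = 1 := by
    rw [← NNReal.coe_add, add_tsub_cancel_of_le ht, NNReal.coe_one]
  have hprob : IsProbabilityMeasure ((t : ℝ≥0∞) • (μ₁ : Measure E) +
      ((1 - t : ℝ≥0) : ℝ≥0∞) • (μ₂ : Measure E)) := by
    refine ⟨?_⟩
    simp only [Measure.coe_add, Measure.coe_smul, Pi.add_apply, Pi.smul_apply, measure_univ,
      smul_eq_mul, mul_one]
    rw [← ENNReal.coe_add, add_tsub_cancel_of_le ht, ENNReal.coe_one]
  rw [extend, dif_pos hprob]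
  refine iSup_le fun f => iSup_le fun hf => iSup_le fun hb => ?_
  obtain ⟨C, hC⟩ := hb
  have hi : ∀ μ : ProbabilityMeasure E, Integrable f (μ : Measure E) := fun μ =>
    integrable_of_abs_le hf.measurable hC
  have hint : ∫ x, f x ∂((t : ℝ≥0∞) • (μ₁ : Measure E) +
      ((1 - t : ℝ≥0) : ℝ≥0∞) • (μ₂ : Measure E))
      = t * ∫ x, f x ∂(μ₁ : Measure E) + ((1 - t : ℝ≥0) : ℝ) * ∫ x, f x ∂(μ₂ : Measure E) := by
    rw [integral_add_measure ((hi μ₁).smul_measure ENNReal.coe_ne_top)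
      ((hi μ₂).smul_measure ENNReal.coe_ne_top), integral_smul_measure, integral_smul_measure]
    simp only [ENNReal.coe_toReal, smul_eq_mul]
  have key : ∫ x, f x ∂((t : ℝ≥0∞) • (μ₁ : Measure E) +
      ((1 - t : ℝ≥0) : ℝ≥0∞) • (μ₂ : Measure E)) - ρ f
      = t * (∫ x, f x ∂(μ₁ : Measure E) - ρ f)
        + ((1 - t : ℝ≥0) : ℝ) * (∫ x, f x ∂(μ₂ : Measure E) - ρ f) := by
    rw [hint]
    linear_combination (ρ f) * hsum
  simp only [ProbabilityMeasure.coe_mk]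
  rw [← EReal.coe_sub, key, EReal.coe_add, EReal.coe_mul, EReal.coe_mul]
  gcongr
  · exact coe_sub_le_dualAlpha hf ⟨C, hC⟩
  · exact coe_sub_le_dualAlpha hf ⟨C, hC⟩

variable [PolishSpace E] [BorelSpace E] [Nonempty E]

/-- The sub-level sets of `dualAlpha ρ` are weakly compact if `ρ` is continuous along sequences of
bounded continuous functions decreasing to zero. -/
lemma isCompact_dualAlpha_le
    (hcont : ∀ fs : ℕ → E →ᵇ ℝ, (∀ x, Antitone fun m => fs m x) →
      (∀ x, Tendsto (fun m => fs m x) atTop (𝓝 0)) →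
      Tendsto (fun m => ρ (fs m)) atTop (𝓝 (ρ fun _ => 0))) (c : ℝ) :
    IsCompact {ν : ProbabilityMeasure E | dualAlpha ρ ν ≤ (c : EReal)} := by
  refine isCompact_iff_ultrafilter_le_nhds.2 fun F hF => ?_
  rw [le_principal_iff] at hF
  have hlim : ∀ u : E →ᵇ ℝ, ∃ l : ℝ,
      Tendsto (fun ν : ProbabilityMeasure E => ∫ x, u x ∂(ν : Measure E)) F (𝓝 l) := by
    intro u
    obtain ⟨l, -, hl⟩ := (isCompact_Icc (a := -‖u‖) (b := ‖u‖)).ultrafilter_le_nhds'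
      (F.map fun ν : ProbabilityMeasure E => ∫ x, u x ∂(ν : Measure E)) (by
        rw [Ultrafilter.mem_map]
        refine univ_mem' fun ν => ?_
        have h := norm_integral_le_of_norm_le_const (μ := (ν : Measure E))
          (ae_of_all _ u.norm_coe_le_norm)
        simpa [abs_le] using h)
    exact ⟨l, hl⟩
  choose L hL using hlim
  let ℓ : (E →ᵇ ℝ) →ₗ[ℝ] ℝ :=
    { toFun := L
      map_add' := fun u v => tendsto_nhds_unique (hL (u + v)) (by
        refine ((hL u).add (hL v)).congr fun ν => ?_
        rw [← integral_add (u.integrable _) (v.integrable _)]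
        rfl)
      map_smul' := fun a u => tendsto_nhds_unique (hL (a • u)) (by
        refine ((hL u).const_mul a).congr fun ν => ?_
        rw [← integral_const_mul]
        rfl) }
  have hpos : ∀ u : E →ᵇ ℝ, (∀ x, 0 ≤ u x) → 0 ≤ ℓ u := fun u hu =>
    ge_of_tendsto' (hL u) fun ν => integral_nonneg hu
  have hle : ∀ u : E →ᵇ ℝ, ℓ u - ρ u ≤ c := fun u => by
    refine le_of_tendsto ((hL u).sub_const (ρ u)) ?_
    filter_upwards [hF] with ν hν
    exact dualAlpha_le_coe_iff.1 hν u
  obtain ⟨ν, hν⟩ := exists_probabilityMeasure_of_linear ℓ hpos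
    (tendsto_nhds_unique (hL 1) (by simp)) fun u hanti hu => by
      have hu0 : ∀ n x, 0 ≤ u n x := fun n x => (hanti x).le_of_tendsto (hu x) n
      refine tendsto_order.2 ⟨fun a ha => .of_forall fun n => ha.trans_le (hpos _ (hu0 n)),
        fun ε hε => ?_⟩
      set M := |ρ (fun _ => 0) + c| + 1 with hM
      have hMpos : 0 < M := by positivity
      have h1 := hcont (fun n => (M / ε) • u n)
        (fun x m n hmn => mul_le_mul_of_nonneg_left (hanti x hmn) (by positivity))
        (fun x => by simpa using (hu x).const_mul (M / ε))
      filter_upwards [h1.eventually_lt_const (lt_add_one _)] with n hn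
      have h2 := hle ((M / ε) • u n)
      rw [map_smul, smul_eq_mul] at h2
      have h3 : M / ε * ℓ (u n) < M := by
        have := le_abs_self (ρ (fun _ => 0) + c)
        linarith
      rw [div_mul_eq_mul_div, div_lt_iff₀ hε] at h3
      exact lt_of_mul_lt_mul_left h3 hMpos.le
  refine ⟨ν, dualAlpha_le_coe_iff.2 fun u => by rw [hν]; exact hle u, ?_⟩
  change Tendsto id (F : Filter (ProbabilityMeasure E)) (𝓝 ν)
  refine ProbabilityMeasure.tendsto_iff_forall_integral_tendsto.2 fun u => ?_
  rw [hν]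
  exact hL u

/-- If `g` is the limit of a decreasing sequence of bounded continuous functions, then the dual
supremum for `ρ g` is attained. -/
lemma exists_dualAlpha_le
    (hconv : ∀ f g : E → ℝ, Measurable f → (∃ C : ℝ, ∀ x, |f x| ≤ C) → Measurable g →
      (∃ C : ℝ, ∀ x, |g x| ≤ C) → ∀ t : ℝ, 0 ≤ t → t ≤ 1 →
      ρ (fun x => t * f x + (1 - t) * g x) ≤ t * ρ f + (1 - t) * ρ g)
    (hR1 : ∀ f g : E → ℝ, Measurable f → (∃ C : ℝ, ∀ x, |f x| ≤ C) → Measurable g →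
      (∃ C : ℝ, ∀ x, |g x| ≤ C) → (∀ x, g x ≤ f x) → ρ g ≤ ρ f)
    (hR2 : ∀ f : E → ℝ, Measurable f → (∃ C : ℝ, ∀ x, |f x| ≤ C) → ∀ c : ℝ,
      ρ (fun x => f x + c) = ρ f + c)
    (hR4 : ∀ (fs : ℕ → E → ℝ) (f : E → ℝ), (∀ m, Continuous (fs m)) →
      (∀ m, ∃ C : ℝ, ∀ x, |fs m x| ≤ C) → Measurable f → (∃ C : ℝ, ∀ x, |f x| ≤ C) →
      (∀ x, Antitone fun m => fs m x) →
      (∀ x, Filter.Tendsto (fun m => fs m x) Filter.atTop (𝓝 (f x))) →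
      Filter.Tendsto (fun m => ρ (fs m)) Filter.atTop (𝓝 (ρ f)))
    {h : ℕ → E → ℝ} {g : E → ℝ} {C : ℝ} (hh : ∀ n, Continuous (h n)) (hhC : ∀ n x, |h n x| ≤ C)
    (hg : Measurable g) (hgC : ∀ x, |g x| ≤ C) (hanti : ∀ x, Antitone fun n => h n x)
    (hlim : ∀ x, Tendsto (fun n => h n x) atTop (𝓝 (g x))) :
    ∃ ν : ProbabilityMeasure E,
      dualAlpha ρ ν ≤ ((∫ x, g x ∂(ν : Measure E) - ρ g : ℝ) : EReal) := by
  let G : (E →ᵇ ℝ) × ℝ → E → ℝ := fun p x => p.1 x + p.2 * g x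
  have hGm : ∀ p, Measurable (G p) := fun p =>
    p.1.continuous.measurable.add (hg.const_mul _)
  have hGb : ∀ p, ∃ C' : ℝ, ∀ x, |G p x| ≤ C' := fun p => by
    refine ⟨‖p.1‖ + |p.2| * C, fun x => (abs_add_le _ _).trans ?_⟩
    rw [abs_mul]
    exact add_le_add (p.1.norm_coe_le_norm x) (mul_le_mul_of_nonneg_left (hgC x) (abs_nonneg _))
  have hφ : ConvexOn ℝ univ fun p => ρ (G p) := by
    refine ⟨convex_univ, fun p _ q _ s t hs ht hst => ?_⟩
    obtain rfl : t = 1 - s := by linarith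
    refine le_trans (le_of_eq (congrArg ρ ?_))
      (hconv _ _ (hGm p) (hGb p) (hGm q) (hGb q) s hs (by linarith))
    ext x
    simp only [G, Prod.fst_add, Prod.smul_fst, Prod.snd_add, Prod.smul_snd, smul_eq_mul,
      BoundedContinuousFunction.coe_add, BoundedContinuousFunction.coe_smul, Pi.add_apply]
    ring
  obtain ⟨m, hm⟩ := exists_subgradient hφ (0, 1)
  have hG1 : G (0, 1) = g := by ext x; simp [G]
  simp only [hG1] at hm
  let ℓ : (E →ᵇ ℝ) →ₗ[ℝ] ℝ := m ∘ₗ LinearMap.inl ℝ _ _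
  have hℓ : ∀ u : E →ᵇ ℝ, ℓ u ≤ ρ (fun x => g x + u x) - ρ g := fun u => by
    have h1 := hm (u, 0)
    have h2 : G ((0, 1) + (u, 0)) = fun x => g x + u x := by
      ext x; simp [G, add_comm]
    rw [h2] at h1
    exact le_sub_iff_add_le'.2 h1
  have hub : ∀ u : E →ᵇ ℝ, ∃ C' : ℝ, ∀ x, |g x + u x| ≤ C' := fun u =>
    ⟨C + ‖u‖, fun x => (abs_add_le _ _).trans (add_le_add (hgC x) (u.norm_coe_le_norm x))⟩
  have hum : ∀ u : E →ᵇ ℝ, Measurable fun x => g x + u x := fun u =>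
    hg.add u.continuous.measurable
  have hpos : ∀ u : E →ᵇ ℝ, (∀ x, 0 ≤ u x) → 0 ≤ ℓ u := fun u hu => by
    have h1 := hℓ (-u)
    have h2 := hR1 g (fun x => g x + (-u) x) hg ⟨C, hgC⟩ (hum _) (hub _)
      fun x => by simpa using hu x
    rw [map_neg] at h1
    linarith
  have hone : ℓ 1 = 1 := by
    have h1 := hℓ 1
    have h2 := hℓ (-1)
    have e1 : ρ (fun x => g x + (1 : E →ᵇ ℝ) x) = ρ g + 1 := hR2 g hg ⟨C, hgC⟩ 1
    have e2 : ρ (fun x => g x + (-1 : E →ᵇ ℝ) x) = ρ g + -1 := hR2 g hg ⟨C, hgC⟩ (-1)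
    rw [map_neg] at h2
    linarith
  obtain ⟨ν, hν⟩ := exists_probabilityMeasure_of_linear ℓ hpos hone fun u huanti hu => by
    have hu0 : ∀ n x, 0 ≤ u n x := fun n x => (huanti x).le_of_tendsto (hu x) n
    have hbd : ∀ n, ∃ C' : ℝ, ∀ x, |h n x + u n x| ≤ C' := fun n =>
      ⟨C + ‖u n‖, fun x =>
        (abs_add_le _ _).trans (add_le_add (hhC n x) ((u n).norm_coe_le_norm x))⟩
    have h1 := hR4 (fun n x => h n x + u n x) g (fun n => (hh n).add (u n).continuous) hbd hg
      ⟨C, hgC⟩ (fun x => (hanti x).add (huanti x))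
      (fun x => by simpa using (hlim x).add (hu x))
    refine squeeze_zero (g := fun n => ρ (fun x => h n x + u n x) - ρ g)
      (fun n => hpos _ (hu0 n)) (fun n => (hℓ (u n)).trans ?_) (by simpa using h1.sub_const (ρ g))
    refine sub_le_sub_right (hR1 _ _ ((hh n).add (u n).continuous).measurable (hbd n) (hum _)
      (hub _) fun x => ?_) _
    have hgh : g x ≤ h n x := (hanti x).le_of_tendsto (hlim x) n
    exact add_le_add hgh le_rfl
  have hb : m (0, 1) ≤ ∫ x, g x ∂(ν : Measure E) := by
    refine ge_of_tendsto' (tendsto_integral_of_dominated_convergence (fun _ => C)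
      (fun n => (hh n).measurable.aestronglyMeasurable) (integrable_const C)
      (fun n => ae_of_all _ (hhC n)) (ae_of_all _ hlim)) fun n => ?_
    let H : E →ᵇ ℝ := BoundedContinuousFunction.ofNormedAddCommGroup (h n) (hh n) C (hhC n)
    have h1 := hm (-H, 1)
    have h2 : m (-H, 1) = m (0, 1) - ℓ H := by
      have : ((-H, 1) : (E →ᵇ ℝ) × ℝ) = (0, 1) - (H, 0) := by simp
      rw [this, map_sub]
      rfl
    have h3 : ρ (G ((0, 1) + (-H, 1))) ≤ ρ g := by
      refine hR1 _ _ hg ⟨C, hgC⟩ (hGm _) (hGb _) fun x => ?_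
      have h4 : g x ≤ h n x := (hanti x).le_of_tendsto (hlim x) n
      have h5 : H x = h n x := rfl
      simp only [G, Prod.mk_add_mk, zero_add, BoundedContinuousFunction.coe_neg, Pi.neg_apply, h5]
      linarith
    have h4 : ∫ x, h n x ∂(ν : Measure E) = ℓ H := hν H
    rw [h4]
    linarith
  refine ⟨ν, dualAlpha_le_coe_iff.2 fun u => ?_⟩
  rw [hν]
  have h1 := hm (u, -1)
  have h2 : m (u, -1) = ℓ u - m (0, 1) := by
    have : ((u, -1) : (E →ᵇ ℝ) × ℝ) = (u, 0) - (0, 1) := by simp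
    rw [this, map_sub]
    rfl
  have h3 : G ((0, 1) + (u, -1)) = u := by ext x; simp [G]
  rw [h3] at h1
  linarith

/-- The defining inequality of `dualAlpha ρ` extends from bounded continuous to bounded Borel
functions. -/
lemma integral_sub_le_dualAlpha
    (hR1 : ∀ f g : E → ℝ, Measurable f → (∃ C : ℝ, ∀ x, |f x| ≤ C) → Measurable g →
      (∃ C : ℝ, ∀ x, |g x| ≤ C) → (∀ x, g x ≤ f x) → ρ g ≤ ρ f)
    (hR4 : ∀ (fs : ℕ → E → ℝ) (f : E → ℝ), (∀ m, Continuous (fs m)) →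
      (∀ m, ∃ C : ℝ, ∀ x, |fs m x| ≤ C) → Measurable f → (∃ C : ℝ, ∀ x, |f x| ≤ C) →
      (∀ x, Antitone fun m => fs m x) →
      (∀ x, Filter.Tendsto (fun m => fs m x) Filter.atTop (𝓝 (f x))) →
      Filter.Tendsto (fun m => ρ (fs m)) Filter.atTop (𝓝 (ρ f)))
    (ν : ProbabilityMeasure E) {f : E → ℝ} (hf : Measurable f) {C : ℝ} (hC : ∀ x, |f x| ≤ C) :
    ((∫ x, f x ∂(ν : Measure E) - ρ f : ℝ) : EReal) ≤ dualAlpha ρ ν := by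
  refine EReal.ge_of_forall_gt_iff_ge.1 fun z hz => ?_
  rw [EReal.coe_lt_coe_iff] at hz
  obtain ⟨c, hzc, hc⟩ := exists_between (lt_sub_iff_add_lt.1 hz)
  obtain ⟨h, g, hh, hhC, hg, hgC, hanti, hlim, hgf, hch⟩ :=
    exists_continuous_antitone_approx (fun f => ∫ x, f x ∂(ν : Measure E))
      (fun f g hf ⟨_, hfC⟩ hg ⟨_, hgC⟩ hgf =>
        integral_mono (integrable_of_abs_le hg hgC) (integrable_of_abs_le hf hfC) hgf)
      (fun fs f hfs hfsC hf ⟨_, hfC⟩ hmono hlim =>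
        integral_tendsto_of_tendsto_of_monotone
          (fun n => integrable_of_abs_le (hfs n) (hfsC n).choose_spec)
          (integrable_of_abs_le hf hfC) (ae_of_all _ hmono) (ae_of_all _ hlim))
      hf hC hc
  have h1 := hR4 h g hh (fun n => ⟨C, hhC n⟩) hg ⟨C, hgC⟩ hanti hlim
  have h2 := hR1 f g hf ⟨C, hC⟩ hg ⟨C, hgC⟩ hgf
  obtain ⟨n, hn⟩ := (h1.eventually_lt_const
    (show ρ g < ρ f + (c - (z + ρ f)) by linarith)).exists
  refine le_trans (EReal.coe_le_coe_iff.2 ?_) (coe_sub_le_dualAlpha (hh n) ⟨C, hhC n⟩)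
  have := hch n
  linarith

end Duality

/-- **Theorem 2.2**: a convex functional `ρ` on `B(E)` with properties (R1)–(R4) arises from a
convex `α` with weakly compact sub-level sets, namely `dualAlpha ρ`. -/
theorem rho_to_alpha
    {E : Type*} [MeasurableSpace E] [TopologicalSpace E] [PolishSpace E] [BorelSpace E]
    [Nonempty E]
    (ρ : (E → ℝ) → ℝ)
    (hconv : ∀ f g : E → ℝ, Measurable f → (∃ C : ℝ, ∀ x, |f x| ≤ C) → Measurable g →
      (∃ C : ℝ, ∀ x, |g x| ≤ C) → ∀ t : ℝ, 0 ≤ t → t ≤ 1 →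
      ρ (fun x => t * f x + (1 - t) * g x) ≤ t * ρ f + (1 - t) * ρ g)
    (hR1 : ∀ f g : E → ℝ, Measurable f → (∃ C : ℝ, ∀ x, |f x| ≤ C) → Measurable g →
      (∃ C : ℝ, ∀ x, |g x| ≤ C) → (∀ x, g x ≤ f x) → ρ g ≤ ρ f)
    (hR2 : ∀ f : E → ℝ, Measurable f → (∃ C : ℝ, ∀ x, |f x| ≤ C) → ∀ c : ℝ,
      ρ (fun x => f x + c) = ρ f + c)
    (hR3 : ∀ (fs : ℕ → E → ℝ) (f : E → ℝ), (∀ m, Measurable (fs m)) →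
      (∀ m, ∃ C : ℝ, ∀ x, |fs m x| ≤ C) → Measurable f → (∃ C : ℝ, ∀ x, |f x| ≤ C) →
      (∀ x, Monotone fun m => fs m x) →
      (∀ x, Filter.Tendsto (fun m => fs m x) Filter.atTop (𝓝 (f x))) →
      Filter.Tendsto (fun m => ρ (fs m)) Filter.atTop (𝓝 (ρ f)))
    (hR4 : ∀ (fs : ℕ → E → ℝ) (f : E → ℝ), (∀ m, Continuous (fs m)) →
      (∀ m, ∃ C : ℝ, ∀ x, |fs m x| ≤ C) → Measurable f → (∃ C : ℝ, ∀ x, |f x| ≤ C) →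
      (∀ x, Antitone fun m => fs m x) →
      (∀ x, Filter.Tendsto (fun m => fs m x) Filter.atTop (𝓝 (f x))) →
      Filter.Tendsto (fun m => ρ (fs m)) Filter.atTop (𝓝 (ρ f))) :
    -- `dualAlpha ρ` is convex,
    (∀ (μ₁ μ₂ : ProbabilityMeasure E) (t : ℝ≥0), t ≤ 1 →
      extend (dualAlpha ρ) ((t : ℝ≥0∞) • (μ₁ : Measure E) +
          ((1 - t : ℝ≥0) : ℝ≥0∞) • (μ₂ : Measure E))
        ≤ ((t : ℝ) : EReal) * dualAlpha ρ μ₁ +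
          (((1 - t : ℝ≥0) : ℝ) : EReal) * dualAlpha ρ μ₂) ∧
    -- has weakly compact sub-level sets,
    (∀ c : ℝ, IsCompact {ν : ProbabilityMeasure E | dualAlpha ρ ν ≤ (c : EReal)}) ∧
    -- and represents `ρ` on all of `B(E)`.
    (∀ f : E → ℝ, Measurable f → (∃ C : ℝ, ∀ x, |f x| ≤ C) →
      (ρ f : EReal) = ⨆ ν : ProbabilityMeasure E,
        ((∫ x, f x ∂(ν : Measure E) : ℝ) : EReal) - dualAlpha ρ ν) := by
  refine ⟨fun μ₁ μ₂ t ht => extend_dualAlpha_convex μ₁ μ₂ ht, isCompact_dualAlpha_le ?_, ?_⟩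
  · exact fun fs hanti hlim => hR4 _ _ (fun m => (fs m).continuous)
      (fun m => ⟨‖fs m‖, (fs m).norm_coe_le_norm⟩) measurable_const ⟨0, by simp⟩ hanti hlim
  · rintro f hf ⟨C, hC⟩
    refine le_antisymm (EReal.ge_of_forall_gt_iff_ge.1 fun c hc => ?_) (iSup_le fun ν => ?_)
    · rw [EReal.coe_lt_coe_iff] at hc
      obtain ⟨h, g, hh, hhC, hg, hgC, hanti, hlim, hgf, hch⟩ :=
        exists_continuous_antitone_approx ρ hR1 hR3 hf hC hc
      have hcg : c ≤ ρ g :=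
        ge_of_tendsto' (hR4 h g hh (fun n => ⟨C, hhC n⟩) hg ⟨C, hgC⟩ hanti hlim) hch
      obtain ⟨ν, hν⟩ := exists_dualAlpha_le hconv hR1 hR2 hR4 hh hhC hg hgC hanti hlim
      refine le_iSup_of_le ν (le_trans ?_ (EReal.sub_le_sub le_rfl hν))
      rw [← EReal.coe_sub, EReal.coe_le_coe_iff]
      have := integral_mono (integrable_of_abs_le (μ := (ν : Measure E)) hg hgC)
        (integrable_of_abs_le hf hC) hgf
      linarith
    · have h := integral_sub_le_dualAlpha hR1 hR4 ν hf hC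
      refine (EReal.sub_le_sub le_rfl h).trans ?_
      rw [← EReal.coe_sub, sub_sub_cancel]

end SanovDual
end
end
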